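/- There exists a universal constant C > 0 (independent of ε) such that for every ε > 0, every choice of sign ±, and every Schwartz function g on ℝ³, the function u(t,x) = ∫_{ℝ³} exp(i x·ξ ± i (t/ε) ξ₃/|ξ|) ĝ(ξ) dξ satisfies the reversed-norm Strichartz estimate ( ∫_{ℝ³} ( ∫_ℝ |u(t,x)|³ dt )² dx )^{1/6} ≤ C ε^{1/3} ‖g‖_{Ḣ¹}. -/

import Mathlib

open MeasureTheory Complex
open scoped ENNReal RealInnerProductSpace

noncomputable section

/-- Fourier transform `f̂(ξ) = ∫ e^{-i x·ξ} f(x) dx` on `ℝⁿ`. -/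
def fourierTf {n : ℕ} (f : EuclideanSpace ℝ (Fin n) → ℂ) (ξ : EuclideanSpace ℝ (Fin n)) : ℂ :=
  ∫ x : EuclideanSpace ℝ (Fin n), Complex.exp (-Complex.I * Complex.ofReal ⟪x, ξ⟫) * f x

/-- Homogeneous Sobolev norm `‖f‖_{Ḣˢ}` on `ℝⁿ`. -/
def sobolevNorm {n : ℕ} (s : ℝ) (f : EuclideanSpace ℝ (Fin n) → ℂ) : ℝ :=
  (∫ ξ : EuclideanSpace ℝ (Fin n), ‖ξ‖ ^ (2 * s) * ‖fourierTf f ξ‖ ^ 2) ^ (1 / 2 : ℝ)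

/-- The rotation dispersion relation `ξ₃ / |ξ|`. -/
def pRot (ξ : EuclideanSpace ℝ (Fin 3)) : ℝ :=
  ξ 2 / ‖ξ‖

section PlancherelSec
open FourierTransform SchwartzMap

variable {E : Type*} [NormedAddCommGroup E] [InnerProductSpace ℝ E] [FiniteDimensional ℝ E]
  [MeasurableSpace E] [BorelSpace E]

theorem aux_plancherel (f : E → ℂ) (hf : Integrable f) (hf2 : MemLp f 2) :
    eLpNorm (𝓕 f) 2 volume = eLpNorm f 2 volume := by
  set F : Lp ℂ 2 (volume : Measure E) := hf2.toLp f with hF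
  have hcont : Continuous (𝓕 f) := by
    exact VectorFourier.fourierIntegral_continuous Real.continuous_fourierChar
      (by exact continuous_inner) hf
  have hae : (𝓕 f) =ᵐ[volume] (𝓕 F : Lp ℂ 2 (volume : Measure E)) := by
    apply ae_eq_of_integral_contDiff_smul_eq
    · exact hcont.locallyIntegrable
    · exact (Lp.memLp (𝓕 F)).locallyIntegrable (by norm_num)
    · intro g g_smooth g_cpt
      have hg₁ : HasCompactSupport (Complex.ofRealCLM ∘ g) := g_cpt.comp_left rfl
      have hg₂ : ContDiff ℝ ((⊤ : ℕ∞) : WithTop ℕ∞) (Complex.ofRealCLM ∘ g) := by fun_prop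
      set G : 𝓢(E, ℂ) := hg₁.toSchwartzMap hg₂ with hG
      have h1 : (∫ x, g x • (𝓕 F : Lp ℂ 2 (volume : Measure E)) x) = ((𝓕 F : Lp ℂ 2 (volume : Measure E)) : 𝓢'(E, ℂ)) G := by
        simp [G]
      have h2 : ((𝓕 F : Lp ℂ 2 (volume : Measure E)) : 𝓢'(E, ℂ)) G = (F : 𝓢'(E, ℂ)) (𝓕 G) := by
        rw [← Lp.fourier_toTemperedDistribution_eq]; rfl
      have h3 : (F : 𝓢'(E, ℂ)) (𝓕 G) = ∫ x, (𝓕 G) x • f x := by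
        rw [Lp.toTemperedDistribution_apply]
        apply integral_congr_ae
        filter_upwards [hf2.coeFn_toLp] with x hx
        rw [hF, hx]
      have h4 : (∫ x, (𝓕 G) x • f x) = ∫ x, G x • 𝓕 f x := by
        have := VectorFourier.integral_fourierIntegral_smul_eq_flip (μ := (volume : Measure E))
          (ν := (volume : Measure E)) (L := innerₗ E)
          (e := Real.fourierChar) (f := G) (g := f) Real.continuous_fourierChar
          (by exact continuous_inner) G.integrable hf
        have e1 : (innerₗ E).flip = innerₗ E := by ext; simp
        rw [e1] at this
        exact this
      rw [h1, h2, h3, h4]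
      simp [G]
  rw [eLpNorm_congr_ae hae]
  have := Lp.norm_fourier_eq F
  rw [Lp.norm_def, Lp.norm_def] at this
  have h5 := (ENNReal.toReal_eq_toReal_iff' (Lp.eLpNorm_ne_top _) (Lp.eLpNorm_ne_top _)).1 this
  rw [h5, hF, eLpNorm_congr_ae hf2.coeFn_toLp]

/-- Plancherel with kernel `e^{i y·s}`. -/
theorem aux_plancherel2 (f : E → ℂ) (hf : Integrable f) (hf2 : MemLp f 2) :
    ∫⁻ s : E, (‖∫ y : E, Complex.exp (I * ((⟪y, s⟫ : ℝ) : ℂ)) * f y‖ₑ) ^ 2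
      = ENNReal.ofReal ((2 * Real.pi) ^ Module.finrank ℝ E) * ∫⁻ y, ‖f y‖ₑ ^ 2 := by
  have h := aux_plancherel f hf hf2
  rw [eLpNorm_eq_lintegral_rpow_enorm_toReal (by norm_num) (by norm_num),
    eLpNorm_eq_lintegral_rpow_enorm_toReal (by norm_num) (by norm_num)] at h
  have h' : ∫⁻ s : E, ‖𝓕 f s‖ₑ ^ 2 = ∫⁻ y, ‖f y‖ₑ ^ 2 := by
    have := congrArg (fun z => z ^ (2 : ℝ)) h
    simp only [← ENNReal.rpow_mul] at this
    norm_num at this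
    exact this
  have hk : ∀ s : E, (∫ y : E, Complex.exp (I * ((⟪y, s⟫ : ℝ) : ℂ)) * f y)
      = 𝓕 f ((-(2 * Real.pi)⁻¹ : ℝ) • s) := by
    intro s
    rw [Real.fourier_eq']
    congr 1; ext y
    rw [inner_smul_right, smul_eq_mul]
    congr 2
    push_cast
    have : (Real.pi : ℂ) ≠ 0 := by exact_mod_cast Real.pi_ne_zero
    field_simp
  simp_rw [hk]
  have hcont : Continuous (𝓕 f) := by
    exact VectorFourier.fourierIntegral_continuous Real.continuous_fourierChar
      (by exact continuous_inner) hf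
  have hr : (-(2 * Real.pi)⁻¹ : ℝ) ≠ 0 := by
    have := Real.pi_pos
    simp [Real.pi_ne_zero]
  have hm := Measure.map_addHaar_smul (volume : Measure E) hr
  rw [← lintegral_map (μ := (volume : Measure E)) (f := fun s => ‖𝓕 f s‖ₑ ^ 2)
    (g := fun s => (-(2 * Real.pi)⁻¹ : ℝ) • s) (by fun_prop) (by fun_prop), hm,
    lintegral_smul_measure, h', smul_eq_mul]
  congr 2
  rw [abs_inv, abs_pow, abs_neg, abs_inv, inv_pow, inv_inv, abs_of_pos Real.two_pi_pos]

end PlancherelSec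

section GenPlancherel
set_option linter.unusedSectionVars false

variable {E : Type*} [NormedAddCommGroup E] [InnerProductSpace ℝ E] [FiniteDimensional ℝ E]
  [MeasurableSpace E] [BorelSpace E] {X : Type*} [MeasurableSpace X]

theorem aux_norm_exp (r : ℝ) (z : ℂ) : ‖Complex.exp (I * (r : ℂ)) * z‖ = ‖z‖ := by
  rw [norm_mul, mul_comm I, Complex.norm_exp_ofReal_mul_I, one_mul]

theorem aux_gen_cont (μ : Measure X) (S : X → E) (hS : Measurable S)
    (m : X → ℂ) (hm : Integrable m μ) :
    Continuous (fun y : E => ∫ x, Complex.exp (I * ((⟪y, S x⟫ : ℝ) : ℂ)) * m x ∂μ) := by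
  apply continuous_of_dominated (bound := fun x => ‖m x‖)
  · intro y
    refine AEStronglyMeasurable.mul ?_ hm.1
    exact (Measurable.aestronglyMeasurable (by fun_prop))
  · intro y
    exact Filter.Eventually.of_forall (fun x => (aux_norm_exp _ _).le)
  · exact hm.norm
  · exact Filter.Eventually.of_forall (fun x => by fun_prop)

theorem aux_gen_bound (μ : Measure X) (S : X → E) (m : X → ℂ) (y : E) :
    ‖∫ x, Complex.exp (I * ((⟪y, S x⟫ : ℝ) : ℂ)) * m x ∂μ‖ ≤ ∫ x, ‖m x‖ ∂μ := by
  refine (norm_integral_le_integral_norm _).trans (le_of_eq ?_)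
  simp_rw [aux_norm_exp]

theorem aux_ennreal_sq {A B : ℝ≥0∞} (hA : A ≠ ∞) (h : A ≤ B ^ (1 / 2 : ℝ) * A ^ (1 / 2 : ℝ)) :
    A ≤ B := by
  by_cases h0 : A = 0
  · simp [h0]
  have h2 : A ^ (1 / 2 : ℝ) * A ^ (1 / 2 : ℝ) = A := by
    rw [← ENNReal.rpow_add _ _ h0 hA]; norm_num
  have hp : A ^ (1 / 2 : ℝ) ≠ 0 := by simp [h0, hA]
  have hp' : A ^ (1 / 2 : ℝ) ≠ ∞ := by simp [h0, hA]
  have h3 : A ^ (1 / 2 : ℝ) ≤ B ^ (1 / 2 : ℝ) := by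
    rw [← ENNReal.mul_le_mul_iff_left hp hp', h2]; exact h
  exact (ENNReal.rpow_le_rpow_iff (by norm_num)).1 h3

theorem aux_genP (μ : Measure X) [SFinite μ] (S : X → E) (hS : Measurable S)
    (m : X → ℂ) (hm : Integrable m μ) (k j : X → ℝ≥0∞) (hk : Measurable k) (hj : Measurable j)
    (C : ℝ≥0∞)
    (hpush : ∀ Φ : E → ℝ≥0∞, Measurable Φ → ∫⁻ x, Φ (S x) * k x ∂μ ≤ C * ∫⁻ y, Φ y)
    (hmk : ∀ x, ‖m x‖ₑ ^ 2 ≤ j x * k x) :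
    ∫⁻ y : E, ‖∫ x, Complex.exp (I * ((⟪y, S x⟫ : ℝ) : ℂ)) * m x ∂μ‖ₑ ^ 2
      ≤ ENNReal.ofReal ((2 * Real.pi) ^ Module.finrank ℝ E) * C * ∫⁻ x, j x ∂μ := by
  set v : E → ℂ := fun y : E => ∫ x, Complex.exp (I * ((⟪y, S x⟫ : ℝ) : ℂ)) * m x ∂μ with hv
  have hvc : Continuous v := aux_gen_cont μ S hS m hm
  have hvb : ∀ y, ‖v y‖ ≤ ∫ x, ‖m x‖ ∂μ := aux_gen_bound μ S m
  set M := ∫ x, ‖m x‖ ∂μ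
  set c := ENNReal.ofReal ((2 * Real.pi) ^ Module.finrank ℝ E)
  have key : ∀ n : ℕ, ∫⁻ y in Metric.closedBall (0 : E) n, ‖v y‖ₑ ^ 2 ≤ c * C * ∫⁻ x, j x ∂μ := by
    intro n
    set D := Metric.closedBall (0 : E) n
    have hD : MeasurableSet D := Metric.isClosed_closedBall.measurableSet
    have hDf : volume D < ∞ := measure_closedBall_lt_top
    set φ : E → ℂ := D.indicator (fun y => (starRingEnd ℂ) (v y)) with hφ
    have hφm : Measurable φ := (by fun_prop : Measurable fun y => (starRingEnd ℂ) (v y)).indicator hD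
    have hφi : Integrable φ := by
      rw [hφ, integrable_indicator_iff hD]
      refine Measure.integrableOn_of_bounded (M := M) hDf.ne (by fun_prop) ?_
      exact Filter.Eventually.of_forall (fun y => by simpa using hvb y)
    have hφ2 : MemLp φ 2 := by
      rw [hφ, memLp_indicator_iff_restrict hD]
      have : IsFiniteMeasure (volume.restrict D) := ⟨by simpa using hDf⟩
      refine MemLp.of_bound (by fun_prop) M ?_
      exact Filter.Eventually.of_forall (fun y => by simpa using hvb y)
    have hφn : ∫⁻ y, ‖φ y‖ₑ ^ 2 = ∫⁻ y in D, ‖v y‖ₑ ^ 2 := by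
      rw [← lintegral_indicator hD]
      congr 1; ext y
      by_cases hy : y ∈ D <;> simp [φ, hy]
    set A := ∫⁻ y in D, ‖v y‖ₑ ^ 2 with hA
    have hAf : A ≠ ∞ := by
      rw [← hφn]
      have := hφ2.2
      rw [eLpNorm_eq_lintegral_rpow_enorm_toReal (by norm_num) (by norm_num)] at this
      norm_num at this
      intro h
      rw [h] at this
      norm_num at this
    set φh : E → ℂ := fun s => ∫ y : E, Complex.exp (I * ((⟪y, s⟫ : ℝ) : ℂ)) * φ y with hφh
    have hpl : ∫⁻ s, ‖φh s‖ₑ ^ 2 = c * A := by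
      rw [← hφn]; exact aux_plancherel2 φ hφi hφ2
    have hφhc : Continuous φh := by
      have := aux_gen_cont (volume : Measure E) (fun y : E => y) measurable_id φ hφi
      simpa [hφh, real_inner_comm] using this
    -- duality
    have e1 : ‖∫ y, φ y * v y‖ₑ = A := by
      have : (∫ y, φ y * v y) = ∫ y, ((D.indicator (fun y => ‖v y‖ ^ 2) y : ℝ) : ℂ) := by
        congr 1; ext y
        by_cases hy : y ∈ D
        · simp only [φ, hy, Set.indicator_of_mem]
          rw [← Complex.normSq_eq_conj_mul_self, Complex.normSq_eq_norm_sq]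
        · simp [φ, hy]
      have hnn : ∀ y, 0 ≤ D.indicator (fun y => ‖v y‖ ^ 2) y := fun y =>
        Set.indicator_nonneg (fun _ _ => by positivity) y
      rw [this, integral_complex_ofReal]
      rw [← ofReal_norm, Complex.norm_real, Real.norm_of_nonneg (integral_nonneg hnn),
        ofReal_integral_eq_lintegral_ofReal]
      · rw [← hφn]
        congr 1; ext y
        by_cases hy : y ∈ D
        · simp [φ, hy, ENNReal.ofReal_pow]
        · simp [φ, hy]
      · rw [integrable_indicator_iff hD]
        refine Measure.integrableOn_of_bounded (M := M ^ 2) hDf.ne (by fun_prop) ?_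
        refine Filter.Eventually.of_forall (fun y => ?_)
        rw [norm_pow, norm_norm]
        exact pow_le_pow_left₀ (norm_nonneg _) (hvb y) 2
      · exact Filter.Eventually.of_forall hnn
    have e2 : (∫ y, φ y * v y) = ∫ x, m x * φh (S x) ∂μ := by
      have h1 : ∀ y, φ y * v y = ∫ x, φ y * (Complex.exp (I * ((⟪y, S x⟫ : ℝ) : ℂ)) * m x) ∂μ :=
        fun y => (integral_const_mul _ _).symm
      simp_rw [h1]
      rw [integral_integral_swap]
      · congr 1; ext x
        rw [hφh, ← integral_const_mul]
        congr 1; ext y; ring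
      · have hi : Integrable (fun p : E × X => φ p.1 * m p.2) (volume.prod μ) := hφi.mul_prod hm
        refine Integrable.mono hi ?_ ?_
        · have h2 : AEStronglyMeasurable (fun p : E × X => m p.2) (volume.prod μ) :=
            hm.1.comp_snd
          refine AEStronglyMeasurable.mul ?_ (AEStronglyMeasurable.mul ?_ h2)
          · exact (hφm.comp measurable_fst).aestronglyMeasurable
          · exact (Measurable.aestronglyMeasurable (by fun_prop))
        · refine Filter.Eventually.of_forall (fun p => ?_)
          simp only [Function.uncurry]
          rw [norm_mul, aux_norm_exp, norm_mul]
    have e3 : A ≤ ∫⁻ x, j x ^ (1 / 2 : ℝ) * (‖φh (S x)‖ₑ ^ 2 * k x) ^ (1 / 2 : ℝ) ∂μ := by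
      rw [← e1, e2]
      refine (enorm_integral_le_lintegral_enorm _).trans (lintegral_mono (fun x => ?_))
      rw [enorm_mul]
      have h1 : ‖m x‖ₑ ≤ (j x * k x) ^ (1 / 2 : ℝ) := by
        have := ENNReal.rpow_le_rpow (hmk x) (by norm_num : (0 : ℝ) ≤ 1 / 2)
        rw [← ENNReal.rpow_natCast, ← ENNReal.rpow_mul] at this
        norm_num at this
        simpa using this
      have h2 : ‖φh (S x)‖ₑ = (‖φh (S x)‖ₑ ^ 2) ^ (1 / 2 : ℝ) := by
        rw [← ENNReal.rpow_natCast, ← ENNReal.rpow_mul]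
        norm_num
      calc ‖m x‖ₑ * ‖φh (S x)‖ₑ ≤ (j x * k x) ^ (1 / 2 : ℝ) * (‖φh (S x)‖ₑ ^ 2) ^ (1 / 2 : ℝ) := by
            rw [← h2]; gcongr
        _ = _ := by
          rw [ENNReal.mul_rpow_of_nonneg _ _ (by norm_num), ENNReal.mul_rpow_of_nonneg _ _ (by norm_num)]
          ring
    have e4 := ENNReal.lintegral_mul_le_Lp_mul_Lq (p := 2) (q := 2) μ Real.HolderConjugate.two_two
      (f := fun x => j x ^ (1 / 2 : ℝ)) (g := fun x => (‖φh (S x)‖ₑ ^ 2 * k x) ^ (1 / 2 : ℝ))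
      (by fun_prop) (by fun_prop)
    have hh : ∀ z : ℝ≥0∞, (z ^ (1 / 2 : ℝ)) ^ (2 : ℝ) = z := fun z => by
      rw [← ENNReal.rpow_mul]; norm_num
    simp only [hh, Pi.mul_apply] at e4
    have e5 := hpush (fun s => ‖φh s‖ₑ ^ 2) (by fun_prop)
    rw [hpl] at e5
    have e6 : A ≤ (∫⁻ x, j x ∂μ) ^ (1 / 2 : ℝ) * (C * (c * A)) ^ (1 / 2 : ℝ) := by
      refine (e3.trans e4).trans ?_
      gcongr
    apply aux_ennreal_sq hAf
    refine e6.trans (le_of_eq ?_)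
    rw [← ENNReal.mul_rpow_of_nonneg _ _ (by norm_num), ← ENNReal.mul_rpow_of_nonneg _ _ (by norm_num)]
    congr 1; ring
  have hU : (⋃ n : ℕ, Metric.closedBall (0 : E) n) = Set.univ := by
    exact Metric.iUnion_closedBall_nat 0
  rw [← setLIntegral_univ, ← hU, setLIntegral_iUnion_of_directed]
  · exact iSup_le key
  · apply Monotone.directed_le
    intro a b hab
    exact Metric.closedBall_subset_closedBall (by exact_mod_cast hab)

end GenPlancherel

section LemA

variable {X : Type*} [MeasurableSpace X]

theorem aux_half {z : ℝ≥0∞} : (z ^ (1 / 2 : ℝ)) ^ (2 : ℝ) = z := by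
  rw [← ENNReal.rpow_mul]; norm_num

theorem aux_sq_half {a b : ℝ≥0∞} (h : a ^ 2 ≤ b) : a ≤ b ^ (1 / 2 : ℝ) := by
  have := ENNReal.rpow_le_rpow h (by norm_num : (0 : ℝ) ≤ 1 / 2)
  rw [← ENNReal.rpow_natCast, ← ENNReal.rpow_mul] at this
  norm_num at this
  simpa using this

theorem aux_A (μ : Measure X) [SFinite μ] (S : X → ℝ) (hS : Measurable S)
    (m : X → ℂ) (hm : Integrable m μ) (k j : X → ℝ≥0∞) (hk : Measurable k) (hj : Measurable j)
    (C : ℝ≥0∞) (hC0 : C ≠ 0)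
    (hpush : ∀ Φ : ℝ → ℝ≥0∞, Measurable Φ → ∫⁻ x, Φ (S x) * k x ∂μ ≤ C * ∫⁻ y, Φ y)
    (hmk : ∀ x, ‖m x‖ₑ ^ 2 ≤ j x * k x)
    (w : X → ℝ) (hw : Measurable w) (hw0 : ∀ᵐ x ∂μ, 0 < w x) (Cw : ℝ) (hCw : 0 < Cw)
    (hlow : ∀ B : ℝ, 0 < B → ∫⁻ x in {x | w x < B}, k x / ENNReal.ofReal (w x) ∂μ
      ≤ ENNReal.ofReal (Cw * B ^ 2)) :
    ∫⁻ t : ℝ, ‖∫ x, Complex.exp (I * ((t * S x : ℝ) : ℂ)) * m x ∂μ‖ₑ ^ 3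
      ≤ (ENNReal.ofReal (48 * Real.pi * √Cw) * C) *
        (∫⁻ x, j x * ENNReal.ofReal (w x) ∂μ) ^ (3 / 2 : ℝ) := by
  have hpi := Real.pi_pos
  have hsq : 0 < √Cw := Real.sqrt_pos.2 hCw
  set N2 := ∫⁻ x, j x * ENNReal.ofReal (w x) ∂μ with hN2
  by_cases htop : N2 = ∞
  · rw [htop, ENNReal.top_rpow_of_pos (by norm_num), ENNReal.mul_top]
    · exact le_top
    · refine mul_ne_zero ?_ hC0
      rw [ne_eq, ENNReal.ofReal_eq_zero, not_le]
      positivity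
  by_cases hzero : N2 = 0
  · have h1 : ∀ᵐ x ∂μ, m x = 0 := by
      rw [hN2, lintegral_eq_zero_iff (by fun_prop)] at hzero
      filter_upwards [hzero, hw0] with x hx hx0
      have : j x = 0 := by
        rcases mul_eq_zero.1 hx with h | h
        · exact h
        · rw [ENNReal.ofReal_eq_zero] at h; linarith
      have h2 := hmk x
      rw [this] at h2
      simpa using h2
    have h2 : ∀ t : ℝ, ∫ x, Complex.exp (I * ((t * S x : ℝ) : ℂ)) * m x ∂μ = 0 := by
      intro t
      rw [integral_eq_zero_of_ae]
      filter_upwards [h1] with x hx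
      simp [hx]
    simp_rw [h2]
    simp
  -- main case
  set N : ℝ := √N2.toReal with hN
  have hNpos : 0 < N := Real.sqrt_pos.2 (ENNReal.toReal_pos hzero htop)
  have hNN : N2 = ENNReal.ofReal (N ^ 2) := by
    rw [hN, Real.sq_sqrt ENNReal.toReal_nonneg, ENNReal.ofReal_toReal htop]
  have hN2half : N2 ^ (1 / 2 : ℝ) = ENNReal.ofReal N := by
    rw [hNN, ENNReal.ofReal_rpow_of_nonneg (by positivity) (by norm_num), ← Real.sqrt_eq_rpow,
      Real.sqrt_sq hNpos.le]
  set f : ℝ → ℂ := fun t => ∫ x, Complex.exp (I * ((t * S x : ℝ) : ℂ)) * m x ∂μ with hf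
  have hfc : Continuous f := by
    have := aux_gen_cont μ S hS m hm
    simpa [hf, mul_comm] using this
  have hmeas : ∀ l : ℝ, 0 < l → volume {t | l < ‖f t‖} * ENNReal.ofReal (l ^ (3 - 1 : ℝ))
      ≤ ENNReal.ofReal (8 * Real.pi) * C *
        ∫⁻ x, (if l / (2 * √Cw * N) ≤ w x then j x else 0) ∂μ := by
    intro l hl
    set B := l / (2 * √Cw * N) with hB
    have hBpos : 0 < B := by positivity
    set L : Set X := {x | w x < B} with hL
    have hLm : MeasurableSet L := measurableSet_lt hw measurable_const
    -- low part
    have low : ∀ t : ℝ, ‖∫ x in L, Complex.exp (I * ((t * S x : ℝ) : ℂ)) * m x ∂μ‖ ≤ l / 2 := by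
      intro t
      have h1 : ‖∫ x in L, Complex.exp (I * ((t * S x : ℝ) : ℂ)) * m x ∂μ‖ₑ
          ≤ ENNReal.ofReal (l / 2) := by
        calc _ ≤ ∫⁻ x in L, ‖m x‖ₑ ∂μ := by
              refine (enorm_integral_le_lintegral_enorm _).trans (le_of_eq ?_)
              congr 1; ext x
              rw [← ofReal_norm, ← ofReal_norm, aux_norm_exp]
          _ ≤ ∫⁻ x in L, ((j x * ENNReal.ofReal (w x)) ^ (1 / 2 : ℝ)) *
                ((k x / ENNReal.ofReal (w x)) ^ (1 / 2 : ℝ)) ∂μ := by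
              apply lintegral_mono_ae
              filter_upwards [ae_restrict_of_ae hw0] with x hx
              rw [← ENNReal.mul_rpow_of_nonneg _ _ (by norm_num)]
              apply aux_sq_half
              refine (hmk x).trans (le_of_eq ?_)
              rw [mul_assoc, ENNReal.mul_div_cancel]
              · rw [ne_eq, ENNReal.ofReal_eq_zero, not_le]; exact hx
              · exact ENNReal.ofReal_ne_top
          _ ≤ (∫⁻ x in L, (j x * ENNReal.ofReal (w x)) ∂μ) ^ (1 / 2 : ℝ) *
              (∫⁻ x in L, (k x / ENNReal.ofReal (w x)) ∂μ) ^ (1 / 2 : ℝ) := by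
              have := ENNReal.lintegral_mul_le_Lp_mul_Lq (p := 2) (q := 2) (μ.restrict L)
                Real.HolderConjugate.two_two
                (f := fun x => (j x * ENNReal.ofReal (w x)) ^ (1 / 2 : ℝ))
                (g := fun x => (k x / ENNReal.ofReal (w x)) ^ (1 / 2 : ℝ))
                (by fun_prop) (by fun_prop)
              simpa only [aux_half, Pi.mul_apply] using this
          _ ≤ N2 ^ (1 / 2 : ℝ) * (ENNReal.ofReal (Cw * B ^ 2)) ^ (1 / 2 : ℝ) := by
              gcongr
              · exact setLIntegral_le_lintegral _ _
              · exact hlow B hBpos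
          _ = ENNReal.ofReal (l / 2) := by
              rw [hN2half, ENNReal.ofReal_rpow_of_nonneg (by positivity) (by norm_num),
                ← Real.sqrt_eq_rpow, Real.sqrt_mul hCw.le, Real.sqrt_sq hBpos.le,
                ← ENNReal.ofReal_mul hNpos.le]
              congr 1
              rw [hB]; field_simp
      rw [← ofReal_norm] at h1
      exact (ENNReal.ofReal_le_ofReal_iff (by positivity)).1 h1
    -- high part
    set mh : X → ℂ := Lᶜ.indicator m with hmh
    set jh : X → ℝ≥0∞ := Lᶜ.indicator j with hjh
    have hmhi : Integrable mh μ := hm.indicator hLm.compl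
    have high := aux_genP μ S hS mh hmhi k jh hk (hj.indicator hLm.compl) C hpush (by
      intro x
      by_cases hx : x ∈ L
      · simp [mh, jh, hx]
      · simpa [mh, jh, hx] using hmk x)
    set fh : ℝ → ℂ := fun t => ∫ x, Complex.exp (I * ((⟪t, S x⟫ : ℝ) : ℂ)) * mh x ∂μ with hfh
    have hfhc : Continuous fh := aux_gen_cont μ S hS mh hmhi
    have hsplit : ∀ t, f t = (∫ x in L, Complex.exp (I * ((t * S x : ℝ) : ℂ)) * m x ∂μ) + fh t := by
      intro t
      have hi : Integrable (fun x => Complex.exp (I * ((t * S x : ℝ) : ℂ)) * m x) μ := by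
        refine Integrable.mono hm ?_ (Filter.Eventually.of_forall fun x => (aux_norm_exp _ _).le)
        exact AEStronglyMeasurable.mul (Measurable.aestronglyMeasurable (by fun_prop)) hm.1
      rw [hf]
      simp only
      rw [← integral_add_compl hLm hi, hfh]
      congr 1
      rw [← integral_indicator hLm.compl]
      congr 1; ext x
      by_cases hx : x ∈ L
      · simp [mh, hx]
      · simp [mh, hx, mul_comm]
    have hsub : {t | l < ‖f t‖} ⊆ {t | ENNReal.ofReal (l / 2) ^ 2 ≤ ‖fh t‖ₑ ^ 2} := by
      intro t ht
      simp only [Set.mem_ofPred_eq] at ht ⊢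
      gcongr
      rw [← ofReal_norm]
      apply ENNReal.ofReal_le_ofReal
      have h1 := norm_add_le (∫ x in L, Complex.exp (I * ((t * S x : ℝ) : ℂ)) * m x ∂μ) (fh t)
      rw [← hsplit] at h1
      linarith [low t]
    have hche := mul_meas_ge_le_lintegral (μ := (volume : Measure ℝ)) (f := fun t => ‖fh t‖ₑ ^ 2)
      (by fun_prop) (ENNReal.ofReal (l / 2) ^ 2)
    have hjeq : ∫⁻ x, jh x ∂μ = ∫⁻ x, (if B ≤ w x then j x else 0) ∂μ := by
      congr 1; ext x
      by_cases hx : w x < B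
      · simp [jh, L, hx]
      · have := not_lt.1 hx
        simp [jh, L, hx, this]
    rw [hjeq] at high
    calc volume {t | l < ‖f t‖} * ENNReal.ofReal (l ^ (3 - 1 : ℝ))
        ≤ volume {t | ENNReal.ofReal (l / 2) ^ 2 ≤ ‖fh t‖ₑ ^ 2} * ENNReal.ofReal (l ^ (3 - 1 : ℝ)) := by
          gcongr
      _ = ENNReal.ofReal 4 * (ENNReal.ofReal (l / 2) ^ 2 *
            volume {t | ENNReal.ofReal (l / 2) ^ 2 ≤ ‖fh t‖ₑ ^ 2}) := by
          rw [mul_comm, ← mul_assoc]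
          congr 1
          rw [← ENNReal.ofReal_pow (by positivity), ← ENNReal.ofReal_mul (by norm_num)]
          congr 1
          norm_num
          ring
      _ ≤ ENNReal.ofReal 4 * (ENNReal.ofReal ((2 * Real.pi) ^ Module.finrank ℝ ℝ) * C *
            ∫⁻ x, (if B ≤ w x then j x else 0) ∂μ) := by
          exact mul_le_mul_right (hche.trans high) _
      _ = _ := by
          rw [← mul_assoc, ← mul_assoc, ← ENNReal.ofReal_mul (by norm_num)]
          congr 3
          simp; ring
  have hlc := lintegral_rpow_eq_lintegral_meas_lt_mul (volume : Measure ℝ) (f := fun t => ‖f t‖)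
    (p := 3) (Filter.Eventually.of_forall fun t => norm_nonneg _) (by fun_prop) (by norm_num)
  have h3 : ∫⁻ t : ℝ, ‖f t‖ₑ ^ 3 = ∫⁻ t, ENNReal.ofReal (‖f t‖ ^ (3 : ℝ)) := by
    congr 1; ext t
    rw [← ofReal_norm, ← ENNReal.ofReal_pow (norm_nonneg _)]
    norm_cast
  rw [h3, hlc]
  have hq : 0 < 2 * √Cw * N := by positivity
  calc ENNReal.ofReal 3 * ∫⁻ l in Set.Ioi (0 : ℝ), volume {t | l < ‖f t‖} * ENNReal.ofReal (l ^ (3 - 1 : ℝ))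
      ≤ ENNReal.ofReal 3 * ∫⁻ l in Set.Ioi (0 : ℝ), ENNReal.ofReal (8 * Real.pi) * C *
        ∫⁻ x, (if l / (2 * √Cw * N) ≤ w x then j x else 0) ∂μ := by
        gcongr 1
        exact setLIntegral_mono' measurableSet_Ioi (fun l hl => hmeas l hl)
    _ = ENNReal.ofReal 3 * (ENNReal.ofReal (8 * Real.pi) * C *
          ∫⁻ x, (∫⁻ l in Set.Ioi (0 : ℝ), (if l / (2 * √Cw * N) ≤ w x then j x else 0)) ∂μ) := by
        have hmm : Measurable (fun p : ℝ × X => if p.1 / (2 * √Cw * N) ≤ w p.2 then j p.2 else 0) := by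
          apply Measurable.ite
          · exact measurableSet_le (by fun_prop) (by fun_prop)
          · fun_prop
          · fun_prop
        rw [lintegral_const_mul, lintegral_lintegral_swap]
        · exact hmm.aemeasurable
        · exact hmm.lintegral_prod_right'
    _ ≤ ENNReal.ofReal 3 * (ENNReal.ofReal (8 * Real.pi) * C *
          ∫⁻ x, ENNReal.ofReal (2 * √Cw * N) * (j x * ENNReal.ofReal (w x)) ∂μ) := by
        gcongr with x
        refine le_of_eq ?_
        calc ∫⁻ l in Set.Ioi (0 : ℝ), (if l / (2 * √Cw * N) ≤ w x then j x else 0)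
            = ∫⁻ l in Set.Ioi (0 : ℝ), (Set.Iic (2 * √Cw * N * w x)).indicator (fun _ => j x) l := by
              congr 1; ext l
              simp only [Set.indicator, Set.mem_Iic]
              congr 1
              rw [div_le_iff₀ hq, mul_comm]
          _ = ENNReal.ofReal (2 * √Cw * N) * (j x * ENNReal.ofReal (w x)) := by
              rw [lintegral_indicator measurableSet_Iic, lintegral_const,
                Measure.restrict_restrict measurableSet_Iic, Measure.restrict_apply_univ,
                Set.inter_comm, Set.Ioi_inter_Iic, Real.volume_Ioc, sub_zero,
                ENNReal.ofReal_mul hq.le]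
              ring
    _ = _ := by
        rw [lintegral_const_mul _ (by fun_prop), ← hN2]
        have : N2 ^ (3 / 2 : ℝ) = ENNReal.ofReal N * N2 := by
          rw [← hN2half]
          nth_rewrite 3 [← ENNReal.rpow_one N2]
          rw [← ENNReal.rpow_add _ _ hzero htop]; norm_num
        rw [this, ENNReal.ofReal_mul (by positivity : 0 ≤ 2 * √Cw)]
        have h48 : ENNReal.ofReal (48 * Real.pi * √Cw) =
            ENNReal.ofReal 3 * ENNReal.ofReal (8 * Real.pi) * ENNReal.ofReal (2 * √Cw) := by
          rw [← ENNReal.ofReal_mul (by norm_num), ← ENNReal.ofReal_mul (by positivity)]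
          congr 1; ring
        rw [h48]; ring

end LemA

section KSec
open Set

/-- Euclidean norm on `ℝ × ℝ`. -/
def nr (x : ℝ × ℝ) : ℝ := √(x.1 ^ 2 + x.2 ^ 2)

theorem nr_nonneg (x : ℝ × ℝ) : 0 ≤ nr x := Real.sqrt_nonneg _

theorem nr_sq (x : ℝ × ℝ) : nr x ^ 2 = x.1 ^ 2 + x.2 ^ 2 := Real.sq_sqrt (by positivity)

theorem nr_cont : Continuous nr := by unfold nr; fun_prop

@[fun_prop]
theorem nr_meas : Measurable nr := nr_cont.measurable

theorem nr_eq_zero {x : ℝ × ℝ} (h : nr x = 0) : x = 0 := by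
  have h2 := nr_sq x
  rw [h] at h2
  have h3 : x.1 = 0 := by nlinarith [sq_nonneg x.1, sq_nonneg x.2]
  have h4 : x.2 = 0 := by nlinarith [sq_nonneg x.1, sq_nonneg x.2]
  exact Prod.ext h3 h4

theorem nr_zero : nr 0 = 0 := by simp [nr]

theorem nr_pos {x : ℝ × ℝ} (h : x ≠ 0) : 0 < nr x :=
  lt_of_le_of_ne (nr_nonneg x) (fun h' => h (nr_eq_zero h'.symm))

theorem nr_polar {r : ℝ} (hr : 0 ≤ r) (θ : ℝ) : nr (r * Real.cos θ, r * Real.sin θ) = r := by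
  unfold nr
  have : (r * Real.cos θ) ^ 2 + (r * Real.sin θ) ^ 2 = r ^ 2 := by
    have := Real.cos_sq_add_sin_sq θ
    linear_combination r ^ 2 * this
  simp only [this]
  exact Real.sqrt_sq hr

theorem dot_le (q : ℝ × ℝ) (θ : ℝ) : q.1 * Real.cos θ + q.2 * Real.sin θ ≤ nr q := by
  apply Real.le_sqrt_of_sq_le
  have := Real.cos_sq_add_sin_sq θ
  nlinarith [sq_nonneg (q.1 * Real.sin θ - q.2 * Real.cos θ)]

theorem aux_ftc {s : Set ℝ} (hs : IsOpen s) (hc : Convex ℝ s) (f f' : ℝ → ℝ)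
    (hf : ∀ x ∈ s, HasDerivAt f (f' x) x) (hf' : ∀ x ∈ s, 0 ≤ f' x) (m M : ℝ)
    (hm : ∀ x ∈ s, m ≤ f x ∧ f x ≤ M) :
    ∫⁻ x in s, ENNReal.ofReal (f' x) ≤ ENNReal.ofReal (M - m) := by
  have hmono : MonotoneOn f s := by
    apply monotoneOn_of_deriv_nonneg hc
    · exact fun x hx => (hf x hx).continuousAt.continuousWithinAt
    · exact fun x hx => (hf x (interior_subset hx)).differentiableAt.differentiableWithinAt
    · intro x hx
      rw [(hf x (interior_subset hx)).deriv]
      exact hf' x (interior_subset hx)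
  have h := lintegral_image_eq_lintegral_deriv_mul_of_monotoneOn hs.measurableSet
    (fun x hx => (hf x hx).hasDerivWithinAt) hmono (fun _ => 1)
  simp only [lintegral_one, Measure.restrict_apply_univ, mul_one] at h
  rw [← h, ← Real.volume_Icc]
  apply measure_mono
  rintro y ⟨x, hx, rfl⟩
  exact hm x hx

theorem aux_ang (q : ℝ × ℝ) (s : ℝ) (hs : nr q < s) :
    ∫⁻ θ in Ioo (-Real.pi) Real.pi,
      ENNReal.ofReal (1 / (s - (q.1 * Real.cos θ + q.2 * Real.sin θ)))
      ≤ ENNReal.ofReal (2 * Real.pi / √(s ^ 2 - nr q ^ 2)) := by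
  have hspos : 0 < s := (nr_nonneg q).trans_lt hs
  have hDpos : 0 < s ^ 2 - nr q ^ 2 := by nlinarith [nr_nonneg q]
  set d := √(s ^ 2 - nr q ^ 2) with hd
  have hdpos : 0 < d := Real.sqrt_pos.2 hDpos
  have hd2 : d ^ 2 = s ^ 2 - (q.1 ^ 2 + q.2 ^ 2) := by
    rw [hd, Real.sq_sqrt hDpos.le, nr_sq]
  have hpi := Real.pi_pos
  have : 2 * Real.pi / d = Real.pi / d - (-(Real.pi / d)) := by ring
  rw [this]
  refine aux_ftc isOpen_Ioo (convex_Ioo _ _)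
    (fun θ => 2 / d * Real.arctan (((s + q.1) * Real.tan (θ / 2) - q.2) / d)) _ ?_ ?_ _ _ ?_
  · intro θ hθ
    have hc : 0 < Real.cos (θ / 2) := by
      apply Real.cos_pos_of_mem_Ioo
      constructor <;> linarith [hθ.1, hθ.2]
    have h1 : HasDerivAt (fun θ : ℝ => Real.tan (θ / 2)) (1 / Real.cos (θ / 2) ^ 2 * (1 / 2)) θ := by
      exact (Real.hasDerivAt_tan hc.ne').comp θ ((hasDerivAt_id' θ).div_const 2)
    have h2 := ((((h1.const_mul (s + q.1)).sub_const q.2).div_const d).arctan).const_mul (2 / d)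
    refine h2.congr_deriv ?_
    have hden : 0 < s - (q.1 * Real.cos θ + q.2 * Real.sin θ) := by linarith [dot_le q θ]
    have e1 : Real.cos θ = 2 * Real.cos (θ / 2) ^ 2 - 1 := by
      rw [← Real.cos_two_mul]; congr 1; ring
    have e2 : Real.sin θ = 2 * Real.sin (θ / 2) * Real.cos (θ / 2) := by
      rw [← Real.sin_two_mul]; congr 1; ring
    rw [e1, e2] at hden ⊢
    rw [Real.tan_eq_sin_div_cos]
    have e3 := Real.cos_sq_add_sin_sq (θ / 2)
    set c := Real.cos (θ / 2)
    set σ := Real.sin (θ / 2)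
    have hq1 : 0 < s + q.1 := by
      nlinarith [sq_nonneg q.2]
    have key : d ^ 2 * c ^ 2 + ((s + q.1) * σ - q.2 * c) ^ 2 =
        (s + q.1) * (s - (q.1 * (2 * c ^ 2 - 1) + q.2 * (2 * σ * c))) := by
      rw [hd2]
      linear_combination (-(s + q.1) ^ 2 + (s + q.1) * 0 + 2 * (s + q.1) ^ 2) * e3
    have key2 : 1 + (((s + q.1) * (σ / c) - q.2) / d) ^ 2 =
        ((s + q.1) * (s - (q.1 * (2 * c ^ 2 - 1) + q.2 * (2 * σ * c)))) / (d ^ 2 * c ^ 2) := by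
      rw [← key]; field_simp
    rw [key2]
    field_simp
  · intro θ hθ
    have : 0 < s - (q.1 * Real.cos θ + q.2 * Real.sin θ) := by linarith [dot_le q θ]
    positivity
  · intro θ hθ
    have h1 := Real.arctan_lt_pi_div_two (((s + q.1) * Real.tan (θ / 2) - q.2) / d)
    have h2 := Real.neg_pi_div_two_lt_arctan (((s + q.1) * Real.tan (θ / 2) - q.2) / d)
    have h3 : Real.pi / d = 2 / d * (Real.pi / 2) := by field_simp
    have h4 : 0 < 2 / d := by positivity
    rw [h3]
    constructor
    · nlinarith
    · nlinarith

theorem aux_radial (q : ℝ × ℝ) (θ : ℝ) (hq : q.1 * Real.cos θ + q.2 * Real.sin θ ≠ nr q)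
    (Ψ : ℝ → ℝ≥0∞) :
    ∫⁻ r in Ioi (0 : ℝ), Ψ (r + nr (q - (r * Real.cos θ, r * Real.sin θ))) *
        ENNReal.ofReal (1 / nr (q - (r * Real.cos θ, r * Real.sin θ)))
      ≤ ∫⁻ s in Ioi (nr q), Ψ s *
        ENNReal.ofReal (1 / (s - (q.1 * Real.cos θ + q.2 * Real.sin θ))) := by
  set κ := q.1 * Real.cos θ + q.2 * Real.sin θ with hκ
  have hκle : κ ≤ nr q := dot_le q θ
  have hκlt : κ < nr q := lt_of_le_of_ne hκle hq
  have hnn := nr_nonneg q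
  have hsq : ∀ r : ℝ, nr (q - (r * Real.cos θ, r * Real.sin θ)) ^ 2 = nr q ^ 2 - 2 * r * κ + r ^ 2 := by
    intro r
    rw [nr_sq, nr_sq, hκ]
    simp only [Prod.fst_sub, Prod.snd_sub]
    linear_combination r ^ 2 * Real.cos_sq_add_sin_sq θ
  set ρ : ℝ → ℝ := fun s => (s ^ 2 - nr q ^ 2) / (2 * (s - κ)) with hρ
  have hκ2 : κ ^ 2 ≤ nr q ^ 2 := by
    have h1 : -κ ≤ nr q := by
      have := dot_le (-q) θ
      have e : nr (-q) = nr q := by simp [nr]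
      rw [e] at this
      simp only [Prod.fst_neg, Prod.snd_neg] at this
      rw [hκ]; linarith
    nlinarith
  have hnum : ∀ s, nr q < s → 0 < s ^ 2 - 2 * s * κ + nr q ^ 2 := by
    intro s hs
    nlinarith [sq_nonneg (s - κ), sub_pos.2 (hκle.trans_lt hs), mul_pos (sub_pos.2 (hκle.trans_lt hs)) (sub_pos.2 (hκle.trans_lt hs))]
  have hsub : ∀ s, nr q < s → s - ρ s = (s ^ 2 - 2 * s * κ + nr q ^ 2) / (2 * (s - κ)) := by
    intro s hs
    have : 0 < s - κ := by linarith
    rw [hρ]; field_simp; ring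
  have hsubpos : ∀ s, nr q < s → 0 < s - ρ s := by
    intro s hs
    rw [hsub s hs]
    have : 0 < s - κ := by linarith
    exact div_pos (hnum s hs) (by linarith)
  have hnrρ : ∀ s, nr q < s → nr (q - (ρ s * Real.cos θ, ρ s * Real.sin θ)) = s - ρ s := by
    intro s hs
    have h1 : 0 < s - κ := by linarith
    rw [← sq_eq_sq₀ (nr_nonneg _) (hsubpos s hs).le, hsq]
    rw [hρ]; field_simp; ring
  have hleft : ∀ s, nr q < s → ρ s + nr (q - (ρ s * Real.cos θ, ρ s * Real.sin θ)) = s := by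
    intro s hs; rw [hnrρ s hs]; ring
  have hinj : InjOn ρ (Ioi (nr q)) := by
    intro s hs s' hs' h
    rw [← hleft s hs, ← hleft s' hs', h]
  have hsurj : Ioi (0 : ℝ) ⊆ ρ '' (Ioi (nr q)) := by
    intro r hr
    have hr0 : 0 < r := hr
    have hn := nr_nonneg (q - (r * Real.cos θ, r * Real.sin θ))
    have hs2 := hsq r
    set n := nr (q - (r * Real.cos θ, r * Real.sin θ))
    refine ⟨r + n, ?_, ?_⟩
    · show nr q < r + n
      by_contra hcon
      push Not at hcon
      have h1 : n ≤ nr q - r := by linarith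
      have h2 : n ^ 2 ≤ (nr q - r) ^ 2 := pow_le_pow_left₀ hn h1 2
      nlinarith
    · have h1 : nr q < r + n := by
        by_contra hcon
        push Not at hcon
        have h1 : n ≤ nr q - r := by linarith
        have h2 : n ^ 2 ≤ (nr q - r) ^ 2 := pow_le_pow_left₀ hn h1 2
        nlinarith
      have h2 : 0 < r + n - κ := by linarith
      rw [hρ]
      simp only
      rw [div_eq_iff (by linarith)]
      linear_combination hs2
  have hder : ∀ s ∈ Ioi (nr q), HasDerivWithinAt ρ ((s - ρ s) / (s - κ)) (Ioi (nr q)) s := by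
    intro s hs
    have hs' : nr q < s := hs
    have h1 : 0 < s - κ := by linarith
    have h2 : HasDerivAt ρ _ s := (((hasDerivAt_id s).pow 2).sub_const (nr q ^ 2)).div
      (((hasDerivAt_id s).sub_const κ).const_mul 2) (by simp; linarith)
    refine (h2.congr_deriv ?_).hasDerivWithinAt
    rw [hsub s hs]
    simp
    field_simp
    ring
  calc _ ≤ ∫⁻ r in ρ '' (Ioi (nr q)), Ψ (r + nr (q - (r * Real.cos θ, r * Real.sin θ))) *
        ENNReal.ofReal (1 / nr (q - (r * Real.cos θ, r * Real.sin θ))) := lintegral_mono_set hsurj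
    _ = _ := by
      rw [lintegral_image_eq_lintegral_abs_deriv_mul measurableSet_Ioi hder hinj]
      apply setLIntegral_congr_fun measurableSet_Ioi
      intro s hs
      have hs' : nr q < s := hs
      have h1 : 0 < s - κ := by linarith
      have h2 := hsubpos s hs
      simp only
      rw [hleft s hs, hnrρ s hs, abs_of_pos (div_pos h2 h1), mul_comm, mul_assoc,
        ← ENNReal.ofReal_mul (by positivity)]
      congr 2
      field_simp

end KSec

section KSec2
open Set

theorem aux_polar (f : ℝ × ℝ → ℝ≥0∞) (hf : Measurable f) :
    ∫⁻ x, f x = ∫⁻ θ in Ioo (-Real.pi) Real.pi, ∫⁻ r in Ioi (0 : ℝ),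
      ENNReal.ofReal r * f (r * Real.cos θ, r * Real.sin θ) := by
  rw [← lintegral_comp_polarCoord_symm, polarCoord_target]
  have : (volume : Measure (ℝ × ℝ)).restrict (Ioi (0 : ℝ) ×ˢ Ioo (-Real.pi) Real.pi) =
      (volume.restrict (Ioi (0 : ℝ))).prod (volume.restrict (Ioo (-Real.pi) Real.pi)) := by
    rw [Measure.prod_restrict]; rfl
  rw [this, lintegral_prod_symm]
  · simp
  · apply Measurable.aemeasurable
    simp only [polarCoord_symm_apply]
    exact Measurable.mul (by fun_prop) (hf.comp (by fun_prop))

theorem aux_null (q : ℝ × ℝ) (hq : q ≠ 0) :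
    ∀ᵐ θ ∂(volume.restrict (Ioo (-Real.pi) Real.pi)),
      q.1 * Real.cos θ + q.2 * Real.sin θ ≠ nr q := by
  rw [ae_restrict_iff' measurableSet_Ioo]
  have hn := nr_pos hq
  have hsub : Set.Subsingleton
      {θ | θ ∈ Ioo (-Real.pi) Real.pi ∧ q.1 * Real.cos θ + q.2 * Real.sin θ = nr q} := by
    have key : ∀ θ, q.1 * Real.cos θ + q.2 * Real.sin θ = nr q → polarCoord.symm (nr q, θ) = q := by
      intro θ h
      have h1 := nr_sq q
      have h2 := Real.cos_sq_add_sin_sq θ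
      have h3 : (nr q * Real.cos θ - q.1) ^ 2 + (nr q * Real.sin θ - q.2) ^ 2 = 0 := by
        linear_combination nr q ^ 2 * h2 - 2 * nr q * h - h1
      have h4 : nr q * Real.cos θ - q.1 = 0 := by nlinarith [sq_nonneg (nr q * Real.cos θ - q.1), sq_nonneg (nr q * Real.sin θ - q.2)]
      have h5 : nr q * Real.sin θ - q.2 = 0 := by nlinarith [sq_nonneg (nr q * Real.cos θ - q.1), sq_nonneg (nr q * Real.sin θ - q.2)]
      rw [polarCoord_symm_apply]
      ext <;> simp <;> linarith
    intro θ hθ θ' hθ'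
    have := polarCoord.symm.injOn (x₁ := (nr q, θ)) (x₂ := (nr q, θ'))
      (by simpa using ⟨hn, hθ.1.1, hθ.1.2⟩) (by simpa using ⟨hn, hθ'.1.1, hθ'.1.2⟩)
      ((key θ hθ.2).trans (key θ' hθ'.2).symm)
    exact (Prod.ext_iff.1 this).2
  have h0 := hsub.measure_zero (volume : Measure ℝ)
  rw [ae_iff]
  refine measure_mono_null ?_ h0
  intro θ hθ
  simpa [and_assoc] using hθ

theorem aux_mul_inv {r : ℝ} (hr : 0 < r) (z : ℝ≥0∞) :
    ENNReal.ofReal r * (ENNReal.ofReal (1 / r) * z) = z := by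
  rw [← mul_assoc, ← ENNReal.ofReal_mul hr.le, mul_one_div_cancel hr.ne', ENNReal.ofReal_one, one_mul]

theorem aux_K2 (q : ℝ × ℝ) (hq : q ≠ 0) (Ψ : ℝ → ℝ≥0∞) (hΨ : Measurable Ψ) :
    ∫⁻ x : ℝ × ℝ, ENNReal.ofReal (1 / nr x) * (Ψ (nr x + nr (q - x)) * ENNReal.ofReal (1 / nr (q - x)))
      ≤ ∫⁻ s in Ioi (nr q), Ψ s * ENNReal.ofReal (2 * Real.pi / √(s ^ 2 - nr q ^ 2)) := by
  rw [aux_polar _ (by fun_prop)]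
  calc _ ≤ ∫⁻ θ in Ioo (-Real.pi) Real.pi, ∫⁻ s in Ioi (nr q), Ψ s *
        ENNReal.ofReal (1 / (s - (q.1 * Real.cos θ + q.2 * Real.sin θ))) := by
        apply lintegral_mono_ae
        filter_upwards [aux_null q hq] with θ hθ
        refine le_trans (le_of_eq ?_) (aux_radial q θ hθ Ψ)
        apply setLIntegral_congr_fun measurableSet_Ioi
        intro r hr
        have hr' : 0 < r := hr
        simp only
        rw [nr_polar hr'.le, aux_mul_inv hr']
    _ = ∫⁻ s in Ioi (nr q), Ψ s * ∫⁻ θ in Ioo (-Real.pi) Real.pi,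
        ENNReal.ofReal (1 / (s - (q.1 * Real.cos θ + q.2 * Real.sin θ))) := by
        rw [lintegral_lintegral_swap]
        · congr 1; ext s
          rw [lintegral_const_mul _ (by fun_prop)]
        · apply Measurable.aemeasurable
          unfold Function.uncurry
          fun_prop
    _ ≤ _ := by
        apply setLIntegral_mono' measurableSet_Ioi
        intro s hs
        gcongr
        exact aux_ang q s hs

theorem aux_K3 (p : ℝ × ℝ) (s : ℝ) :
    ∫⁻ x : ℝ × ℝ, ENNReal.ofReal (1 / nr x) * (if nr (p - x) < s - nr x then
        ENNReal.ofReal (1 / √((s - nr x) ^ 2 - nr (p - x) ^ 2)) else 0)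
      ≤ ENNReal.ofReal (2 * Real.pi) := by
  have hpi := Real.pi_pos
  have hmeas : Measurable (fun x : ℝ × ℝ => ENNReal.ofReal (1 / nr x) * (if nr (p - x) < s - nr x then
        ENNReal.ofReal (1 / √((s - nr x) ^ 2 - nr (p - x) ^ 2)) else 0)) := by
    refine Measurable.mul (by fun_prop) (Measurable.ite ?_ (by fun_prop) (by fun_prop))
    exact measurableSet_lt (by fun_prop) (by fun_prop)
  have hsq : ∀ r θ : ℝ, nr (p - (r * Real.cos θ, r * Real.sin θ)) ^ 2 =
      nr p ^ 2 - 2 * r * (p.1 * Real.cos θ + p.2 * Real.sin θ) + r ^ 2 := by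
    intro r θ
    rw [nr_sq, nr_sq]
    simp only [Prod.fst_sub, Prod.snd_sub]
    linear_combination r ^ 2 * Real.cos_sq_add_sin_sq θ
  by_cases hs : nr p < s
  swap
  · have : ∀ x : ℝ × ℝ, ¬ (nr (p - x) < s - nr x) := by
      intro x hx
      apply hs
      have h1 := nr_nonneg x
      have h2 := nr_nonneg (p - x)
      have h3 : nr p ≤ nr x + nr (p - x) := by
        apply Real.sqrt_le_iff.2
        refine ⟨by positivity, ?_⟩
        have e1 := nr_sq x
        have e2 := nr_sq (p - x)
        simp only [Prod.fst_sub, Prod.snd_sub] at e2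
        have h4 : x.1 * (p.1 - x.1) + x.2 * (p.2 - x.2) ≤ nr x * nr (p - x) := by
          apply le_of_sq_le_sq _ (by positivity)
          rw [mul_pow, e1, e2]
          nlinarith [sq_nonneg (x.1 * (p.2 - x.2) - x.2 * (p.1 - x.1))]
        nlinarith
      linarith
    simp [this]
  have hspos : 0 < s := (nr_nonneg p).trans_lt hs
  set D := s ^ 2 - nr p ^ 2 with hD
  have hDpos : 0 < D := by rw [hD]; nlinarith [nr_nonneg p]
  rw [aux_polar _ hmeas]
  calc _ ≤ ∫⁻ θ in Ioo (-Real.pi) Real.pi, ENNReal.ofReal √D *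
        ENNReal.ofReal (1 / (s - (p.1 * Real.cos θ + p.2 * Real.sin θ))) := by
        apply lintegral_mono
        intro θ
        set κ := s - (p.1 * Real.cos θ + p.2 * Real.sin θ) with hκ
        have hκpos : 0 < κ := by linarith [dot_le p θ]
        have hle : ∀ r ∈ Ioi (0 : ℝ), ENNReal.ofReal r * (ENNReal.ofReal (1 / nr (r * Real.cos θ, r * Real.sin θ)) *
            (if nr (p - (r * Real.cos θ, r * Real.sin θ)) < s - nr (r * Real.cos θ, r * Real.sin θ) then
            ENNReal.ofReal (1 / √((s - nr (r * Real.cos θ, r * Real.sin θ)) ^ 2 -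
              nr (p - (r * Real.cos θ, r * Real.sin θ)) ^ 2)) else 0))
            ≤ (Ioo 0 (D / (2 * κ))).indicator (fun r => ENNReal.ofReal (1 / √(D - 2 * r * κ))) r := by
          intro r hr
          have hr' : 0 < r := hr
          rw [nr_polar hr'.le, aux_mul_inv hr']
          split_ifs with hc
          · have h2 : (s - r) ^ 2 - nr (p - (r * Real.cos θ, r * Real.sin θ)) ^ 2 = D - 2 * r * κ := by
              rw [hsq, hD, hκ]; ring
            have h3 : 0 < D - 2 * r * κ := by
              rw [← h2]
              have := nr_nonneg (p - (r * Real.cos θ, r * Real.sin θ))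
              nlinarith
            rw [indicator_of_mem]
            · rw [h2]
            · refine ⟨hr', ?_⟩
              rw [lt_div_iff₀ (by positivity)]
              linarith
          · exact zero_le
        refine (setLIntegral_mono' measurableSet_Ioi hle).trans ?_
        refine (setLIntegral_le_lintegral _ _).trans ?_
        show _ ≤ ENNReal.ofReal √D * ENNReal.ofReal (1 / κ)
        rw [lintegral_indicator measurableSet_Ioo, ← ENNReal.ofReal_mul (Real.sqrt_nonneg _)]
        have e : √D * (1 / κ) = 0 - (-(√D / κ)) := by ring
        rw [e]
        refine aux_ftc isOpen_Ioo (convex_Ioo _ _) (fun r => -(√(D - 2 * r * κ) / κ)) _ ?_ ?_ _ _ ?_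
        · intro r hr
          have h3 : 0 < D - 2 * r * κ := by
            have := hr.2
            rw [lt_div_iff₀ (by positivity)] at this
            linarith
          have h4 : HasDerivAt (fun r : ℝ => D - 2 * r * κ) (-(2 * 1 * κ)) r :=
            (((hasDerivAt_id' r).const_mul 2).mul_const κ).const_sub D
          have h5 := ((h4.sqrt h3.ne').div_const κ).neg
          refine h5.congr_deriv ?_
          have := Real.sqrt_pos.2 h3
          field_simp
        · intro r hr; positivity
        · intro r hr
          constructor
          · apply neg_le_neg
            gcongr
            have := mul_pos hr.1 hκpos
            linarith
          · have : 0 ≤ √(D - 2 * r * κ) / κ := by positivity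
            linarith
    _ = ENNReal.ofReal √D * ∫⁻ θ in Ioo (-Real.pi) Real.pi,
        ENNReal.ofReal (1 / (s - (p.1 * Real.cos θ + p.2 * Real.sin θ))) := by
        rw [lintegral_const_mul _ (by fun_prop)]
    _ ≤ ENNReal.ofReal √D * ENNReal.ofReal (2 * Real.pi / √D) := by
        gcongr
        exact aux_ang p s hs
    _ = _ := by
        rw [← ENNReal.ofReal_mul (Real.sqrt_nonneg _)]
        have := Real.sqrt_pos.2 hDpos
        congr 1; field_simp

theorem aux_K (Ψ : (ℝ × ℝ) × ℝ → ℝ≥0∞) (hΨ : Measurable Ψ) :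
    ∫⁻ x : ℝ × ℝ, ∫⁻ y : ℝ × ℝ, ∫⁻ z : ℝ × ℝ, Ψ (x + y + z, nr x + nr y + nr z) *
      (ENNReal.ofReal (1 / nr x) * ENNReal.ofReal (1 / nr y) * ENNReal.ofReal (1 / nr z))
      ≤ ENNReal.ofReal (2 * Real.pi) * ENNReal.ofReal (2 * Real.pi) * ∫⁻ p : ℝ × ℝ, ∫⁻ s : ℝ, Ψ (p, s) := by
  have hpi := Real.pi_pos
  calc _ = ∫⁻ x : ℝ × ℝ, ∫⁻ y : ℝ × ℝ, ∫⁻ p : ℝ × ℝ,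
        Ψ (p, nr x + nr y + nr (p - x - y)) *
        (ENNReal.ofReal (1 / nr x) * ENNReal.ofReal (1 / nr y) * ENNReal.ofReal (1 / nr (p - x - y))) := by
        congr 1; ext x
        congr 1; ext y
        rw [← lintegral_add_left_eq_self (fun p : ℝ × ℝ => Ψ (p, nr x + nr y + nr (p - x - y)) *
          (ENNReal.ofReal (1 / nr x) * ENNReal.ofReal (1 / nr y) * ENNReal.ofReal (1 / nr (p - x - y)))) (x + y)]
        congr 1; ext z
        have : x + y + z - x - y = z := by abel
        rw [this]
    _ = ∫⁻ x : ℝ × ℝ, ∫⁻ p : ℝ × ℝ, ∫⁻ y : ℝ × ℝ,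
        Ψ (p, nr x + nr y + nr (p - x - y)) *
        (ENNReal.ofReal (1 / nr x) * ENNReal.ofReal (1 / nr y) * ENNReal.ofReal (1 / nr (p - x - y))) := by
        congr 1; ext x
        rw [lintegral_lintegral_swap]
        apply Measurable.aemeasurable
        unfold Function.uncurry
        fun_prop
    _ = ∫⁻ p : ℝ × ℝ, ∫⁻ x : ℝ × ℝ, ∫⁻ y : ℝ × ℝ,
        Ψ (p, nr x + nr y + nr (p - x - y)) *
        (ENNReal.ofReal (1 / nr x) * ENNReal.ofReal (1 / nr y) * ENNReal.ofReal (1 / nr (p - x - y))) := by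
        rw [lintegral_lintegral_swap]
        apply Measurable.aemeasurable
        unfold Function.uncurry
        apply Measurable.lintegral_prod_right' (f := fun q : ((ℝ × ℝ) × (ℝ × ℝ)) × (ℝ × ℝ) =>
          Ψ (q.1.2, nr q.1.1 + nr q.2 + nr (q.1.2 - q.1.1 - q.2)) *
            (ENNReal.ofReal (1 / nr q.1.1) * ENNReal.ofReal (1 / nr q.2) *
              ENNReal.ofReal (1 / nr (q.1.2 - q.1.1 - q.2))))
        fun_prop
    _ ≤ ∫⁻ p : ℝ × ℝ, ∫⁻ x : ℝ × ℝ, ∫⁻ s : ℝ, Ψ (p, s) * (ENNReal.ofReal (2 * Real.pi) *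
          (ENNReal.ofReal (1 / nr x) * (if nr (p - x) < s - nr x then
            ENNReal.ofReal (1 / √((s - nr x) ^ 2 - nr (p - x) ^ 2)) else 0))) := by
        apply lintegral_mono; intro p
        apply lintegral_mono_ae
        have hne : ∀ᵐ x : ℝ × ℝ, x ≠ p := by
          rw [ae_iff]; simp
        filter_upwards [hne] with x hx
        have hq : p - x ≠ 0 := sub_ne_zero.2 (Ne.symm hx)
        have h2 := aux_K2 (p - x) hq (fun s => Ψ (p, nr x + s)) (by fun_prop)
        calc _ = ENNReal.ofReal (1 / nr x) * ∫⁻ y : ℝ × ℝ, ENNReal.ofReal (1 / nr y) *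
              (Ψ (p, nr x + (nr y + nr (p - x - y))) * ENNReal.ofReal (1 / nr (p - x - y))) := by
              rw [← lintegral_const_mul _ (by fun_prop)]
              congr 1; ext y
              rw [← add_assoc]; ring
          _ ≤ ENNReal.ofReal (1 / nr x) * ∫⁻ s in Ioi (nr (p - x)), Ψ (p, nr x + s) *
              ENNReal.ofReal (2 * Real.pi / √(s ^ 2 - nr (p - x) ^ 2)) := by gcongr
          _ = ∫⁻ s, (Ioi (nr (p - x))).indicator (fun s => Ψ (p, nr x + s) *
              (ENNReal.ofReal (2 * Real.pi) * (ENNReal.ofReal (1 / nr x) * ENNReal.ofReal (1 / √(s ^ 2 - nr (p - x) ^ 2))))) s := by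
              rw [lintegral_indicator measurableSet_Ioi, ← lintegral_const_mul _ (by fun_prop)]
              congr 1; ext s
              have e : 2 * Real.pi / √(s ^ 2 - nr (p - x) ^ 2) =
                2 * Real.pi * (1 / √(s ^ 2 - nr (p - x) ^ 2)) := by ring
              rw [e, ENNReal.ofReal_mul (by positivity)]
              ring
          _ = _ := by
              rw [← lintegral_add_left_eq_self (fun s : ℝ => Ψ (p, s) * (ENNReal.ofReal (2 * Real.pi) *
                (ENNReal.ofReal (1 / nr x) * (if nr (p - x) < s - nr x then
                ENNReal.ofReal (1 / √((s - nr x) ^ 2 - nr (p - x) ^ 2)) else 0)))) (nr x)]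
              congr 1; ext s
              simp only [indicator, mem_Ioi, add_sub_cancel_left]
              split_ifs <;> simp
    _ = ∫⁻ p : ℝ × ℝ, ∫⁻ s : ℝ, Ψ (p, s) * (ENNReal.ofReal (2 * Real.pi) *
          ∫⁻ x : ℝ × ℝ, (ENNReal.ofReal (1 / nr x) * (if nr (p - x) < s - nr x then
            ENNReal.ofReal (1 / √((s - nr x) ^ 2 - nr (p - x) ^ 2)) else 0))) := by
        congr 1; ext p
        have hite : Measurable (fun q : (ℝ × ℝ) × ℝ => (if nr (p - q.1) < q.2 - nr q.1 then
            ENNReal.ofReal (1 / √((q.2 - nr q.1) ^ 2 - nr (p - q.1) ^ 2)) else 0)) := by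
          refine Measurable.ite ?_ (by fun_prop) (by fun_prop)
          exact measurableSet_lt (by fun_prop) (by fun_prop)
        rw [lintegral_lintegral_swap]
        · congr 1; ext s
          have h1 : Measurable (fun x : ℝ × ℝ => (if nr (p - x) < s - nr x then
            ENNReal.ofReal (1 / √((s - nr x) ^ 2 - nr (p - x) ^ 2)) else 0)) :=
            hite.comp (by fun_prop : Measurable fun x : ℝ × ℝ => (x, s))
          rw [lintegral_const_mul, lintegral_const_mul]
          · exact Measurable.mul (by fun_prop) h1
          · exact Measurable.mul (by fun_prop) (Measurable.mul (by fun_prop) h1)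
        · apply Measurable.aemeasurable
          unfold Function.uncurry
          exact Measurable.mul (by fun_prop) (Measurable.mul (by fun_prop) (Measurable.mul (by fun_prop) hite))
    _ ≤ ∫⁻ p : ℝ × ℝ, ∫⁻ s : ℝ, Ψ (p, s) * (ENNReal.ofReal (2 * Real.pi) * ENNReal.ofReal (2 * Real.pi)) := by
        gcongr with p s
        exact aux_K3 p s
    _ = _ := by
        rw [mul_comm (_ * _) (∫⁻ p : ℝ × ℝ, _), ← lintegral_mul_const]
        · congr 1; ext p
          rw [lintegral_mul_const _ (by fun_prop)]
        · exact hΨ.lintegral_prod_right'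

end KSec2

section Transfer

theorem aux_transfer : ∃ e : EuclideanSpace ℝ (Fin 3) ≃ᵐ (ℝ × ℝ) × ℝ,
    MeasurePreserving e volume volume ∧ ∀ v, e v = ((v 0, v 1), v 2) := by
  let e1 : EuclideanSpace ℝ (Fin 3) ≃ᵐ (Fin 3 → ℝ) := (MeasurableEquiv.toLp 2 (Fin 3 → ℝ)).symm
  let e2 : (Fin 3 → ℝ) ≃ᵐ ℝ × (Fin 2 → ℝ) := MeasurableEquiv.piFinSuccAbove (fun _ => ℝ) 2
  let e3 : (Fin 2 → ℝ) ≃ᵐ ℝ × ℝ := MeasurableEquiv.finTwoArrow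
  let e4 : ℝ × (Fin 2 → ℝ) ≃ᵐ (Fin 2 → ℝ) × ℝ := MeasurableEquiv.prodComm
  refine ⟨((e1.trans e2).trans e4).trans (e3.prodCongr (MeasurableEquiv.refl ℝ)), ?_, ?_⟩
  · have h1 : MeasurePreserving e1 volume volume := EuclideanSpace.volume_preserving_symm_measurableEquiv_toLp (Fin 3)
    have h2 : MeasurePreserving e2 volume volume := volume_preserving_piFinSuccAbove (fun _ => ℝ) 2
    have h3 : MeasurePreserving e3 volume volume := volume_preserving_finTwoArrow ℝ
    have h4 : MeasurePreserving e4 volume volume := Measure.measurePreserving_swap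
    have h5 : MeasurePreserving (e3.prodCongr (MeasurableEquiv.refl ℝ)) volume volume :=
      h3.prod (MeasurePreserving.id volume)
    exact h5.comp (h4.comp (h2.comp h1))
  · intro v
    rfl

/-- assembling a vector of `ℝ³` -/
def vec (q : (ℝ × ℝ) × ℝ) : EuclideanSpace ℝ (Fin 3) := !₂[q.1.1, q.1.2, q.2]

theorem vec_mp_emb : MeasurePreserving vec volume volume ∧ MeasurableEmbedding vec := by
  obtain ⟨e, he, hv⟩ := aux_transfer
  have : vec = e.symm := by
    ext1 q
    apply e.injective
    rw [e.apply_symm_apply, hv]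
    simp [vec]
  rw [this]
  exact ⟨he.symm, e.symm.measurableEmbedding⟩

theorem vec_meas : Measurable vec := vec_mp_emb.2.measurable

theorem vec_lint (f : EuclideanSpace ℝ (Fin 3) → ℝ≥0∞) (hf : Measurable f) :
    ∫⁻ v, f v = ∫⁻ p : ℝ × ℝ, ∫⁻ s : ℝ, f (vec (p, s)) := by
  rw [← vec_mp_emb.1.lintegral_comp hf]
  exact lintegral_prod _ (hf.comp vec_meas).aemeasurable

theorem lint_scale (f : ℝ → ℝ≥0∞) (b : ℝ) (hb : b ≠ 0) :
    ∫⁻ s : ℝ, f (b * s) = ENNReal.ofReal |b⁻¹| * ∫⁻ s : ℝ, f s := by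
  have h := Real.map_volume_mul_left hb
  have e : MeasurableEmbedding (fun s : ℝ => b * s) := measurableEmbedding_mulLeft₀ hb
  rw [← e.lintegral_map, h, lintegral_smul_measure, smul_eq_mul]

theorem inner_vec (x : EuclideanSpace ℝ (Fin 3)) (q : (ℝ × ℝ) × ℝ) :
    (⟪x, vec q⟫ : ℝ) = x 0 * q.1.1 + x 1 * q.1.2 + x 2 * q.2 := by
  simp [vec, PiLp.inner_apply, Fin.sum_univ_three]
  ring

theorem aux_B (b : ℝ) (hb : b ≠ 0) (h : ℝ × ℝ → ℂ) (hm : Measurable h) (hi : Integrable h)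
    (h0 : h 0 = 0) :
    ∫⁻ x : EuclideanSpace ℝ (Fin 3), ‖∫ ξ : ℝ × ℝ,
      exp (I * ((⟪x, vec (ξ, b * nr ξ)⟫ : ℝ) : ℂ)) * h ξ‖ₑ ^ 6 ≤
      ENNReal.ofReal ((2 * Real.pi) ^ 5 * |b⁻¹|) * (∫⁻ ξ, ‖h ξ‖ₑ ^ 2 * ENNReal.ofReal (nr ξ)) ^ 3 := by
  have hpi := Real.pi_pos
  have hbpos : 0 < |b⁻¹| := by positivity
  let S : ((ℝ × ℝ) × (ℝ × ℝ)) × (ℝ × ℝ) → EuclideanSpace ℝ (Fin 3) := fun q =>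
    vec (q.1.1 + q.1.2 + q.2, b * (nr q.1.1 + nr q.1.2 + nr q.2))
  have hS : Measurable S := vec_meas.comp (by fun_prop)
  let m : ((ℝ × ℝ) × (ℝ × ℝ)) × (ℝ × ℝ) → ℂ := fun q => h q.1.1 * h q.1.2 * h q.2
  have hmi : Integrable m (volume : Measure (((ℝ × ℝ) × (ℝ × ℝ)) × (ℝ × ℝ))) := (hi.mul_prod hi).mul_prod hi
  let k : ((ℝ × ℝ) × (ℝ × ℝ)) × (ℝ × ℝ) → ℝ≥0∞ := fun q =>
    ENNReal.ofReal (1 / nr q.1.1) * ENNReal.ofReal (1 / nr q.1.2) * ENNReal.ofReal (1 / nr q.2)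
  have hk : Measurable k := by fun_prop
  let l : ℝ × ℝ → ℝ≥0∞ := fun ξ => ‖h ξ‖ₑ ^ 2 * ENNReal.ofReal (nr ξ)
  have hl : Measurable l := by fun_prop
  let j : ((ℝ × ℝ) × (ℝ × ℝ)) × (ℝ × ℝ) → ℝ≥0∞ := fun q => l q.1.1 * l q.1.2 * l q.2
  have hj : Measurable j := by fun_prop
  have key := aux_genP volume S hS m hmi k j hk hj
    (ENNReal.ofReal (2 * Real.pi) * ENNReal.ofReal (2 * Real.pi) * ENNReal.ofReal |b⁻¹|) ?_ ?_
  · calc _ = ∫⁻ x : EuclideanSpace ℝ (Fin 3), ‖∫ q, exp (I * ((⟪x, S q⟫ : ℝ) : ℂ)) * m q‖ₑ ^ 2 := by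
          congr 1; ext x
          set E : ℝ × ℝ → ℂ := fun ξ => exp (I * ((⟪x, vec (ξ, b * nr ξ)⟫ : ℝ) : ℂ)) * h ξ with hE
          have : ∫ q, exp (I * ((⟪x, S q⟫ : ℝ) : ℂ)) * m q = (∫ ξ, E ξ) * (∫ ξ, E ξ) * (∫ ξ, E ξ) := by
            rw [← integral_prod_mul, ← integral_prod_mul (fun z : (ℝ × ℝ) × (ℝ × ℝ) => E z.1 * E z.2)]
            congr 1; ext q
            simp only [hE, m, S, inner_vec]
            have e1 : ∀ a b c u v w : ℂ, a * u * (b * v) * (c * w) = (a * b * c) * (u * v * w) := by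
              intros; ring
            rw [e1, ← Complex.exp_add, ← Complex.exp_add]
            congr 2
            simp only [Prod.fst_add, Prod.snd_add]
            push_cast; ring
          rw [this]
          simp only [enorm_mul]
          ring
      _ ≤ _ := key
      _ = _ := by
          have hX : ∫⁻ q, j q = (∫⁻ ξ, l ξ) ^ 3 := by
            have e1 := lintegral_prod_mul (μ := (volume : Measure ((ℝ × ℝ) × (ℝ × ℝ)))) (ν := (volume : Measure (ℝ × ℝ)))
              (f := fun z => l z.1 * l z.2) (g := l) (by fun_prop) (by fun_prop)
            have e2 := lintegral_prod_mul (μ := (volume : Measure (ℝ × ℝ))) (ν := (volume : Measure (ℝ × ℝ)))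
              (f := l) (g := l) (by fun_prop) (by fun_prop)
            calc _ = _ := e1
              _ = _ := by
                rw [show (∫⁻ z : (ℝ × ℝ) × (ℝ × ℝ), l z.1 * l z.2) = _ from e2]; ring
          rw [hX]
          congr 1
          rw [← ENNReal.ofReal_mul (by positivity), ← ENNReal.ofReal_mul (by positivity),
            ← ENNReal.ofReal_mul (by positivity)]
          congr 1
          simp
          ring
  · intro Φ hΦ
    calc _ = ∫⁻ z : (ℝ × ℝ) × (ℝ × ℝ), ∫⁻ c : ℝ × ℝ, Φ (S (z, c)) * k (z, c) :=
          lintegral_prod _ (by fun_prop)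
      _ = ∫⁻ x : ℝ × ℝ, ∫⁻ y : ℝ × ℝ, ∫⁻ c : ℝ × ℝ, Φ (S ((x, y), c)) * k ((x, y), c) := by
          refine lintegral_prod _ (Measurable.aemeasurable ?_)
          exact Measurable.lintegral_prod_right' (f := fun q => Φ (S q) * k q) (by fun_prop)
      _ ≤ _ := aux_K (fun q => Φ (vec (q.1, b * q.2))) (hΦ.comp (vec_meas.comp (by fun_prop)))
      _ = _ := by
          simp only
          simp_rw [fun p : ℝ × ℝ => lint_scale (fun s => Φ (vec (p, s))) b hb]
          rw [lintegral_const_mul, vec_lint _ hΦ, ← mul_assoc]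
          exact Measurable.lintegral_prod_right' (f := fun q => Φ (vec q)) (hΦ.comp vec_meas)
  · intro q
    have e : ∀ ξ, ‖h ξ‖ₑ ^ 2 ≤ l ξ * ENNReal.ofReal (1 / nr ξ) := by
      intro ξ
      by_cases hξ : ξ = 0
      · simp [hξ, h0]
      · have := nr_pos hξ
        simp only [l]
        rw [mul_assoc, ← ENNReal.ofReal_mul this.le, mul_one_div_cancel this.ne']
        simp
    simp only [m, j, k, enorm_mul]
    calc _ = ‖h q.1.1‖ₑ ^ 2 * ‖h q.1.2‖ₑ ^ 2 * ‖h q.2‖ₑ ^ 2 := by ring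
      _ ≤ _ := mul_le_mul' (mul_le_mul' (e q.1.1) (e q.1.2)) (e q.2)
      _ = _ := by ring

end Transfer

section OneDim
open Set

theorem aux_mink {X Y : Type*} [MeasurableSpace X] [MeasurableSpace Y] (μ : Measure X) [SFinite μ]
    (ν : Measure Y) [SFinite ν] (f : X × Y → ℝ≥0∞) (hf : Measurable f) :
    ∫⁻ x, (∫⁻ a, f (x, a) ∂ν) ^ 3 ∂μ ≤ (∫⁻ a, (∫⁻ x, f (x, a) ^ 3 ∂μ) ^ (1 / 3 : ℝ) ∂ν) ^ 3 := by
  set N : Y → ℝ≥0∞ := fun a => (∫⁻ x, f (x, a) ^ 3 ∂μ) ^ (1 / 3 : ℝ) with hN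
  have hNm : Measurable N := by
    apply Measurable.pow_const
    exact Measurable.lintegral_prod_left' (f := fun q : X × Y => f q ^ 3) (by fun_prop)
  have hold : ∀ a b c, ∫⁻ x, f (x, a) * f (x, b) * f (x, c) ∂μ ≤ N a * N b * N c := by
    intro a b c
    have h := ENNReal.lintegral_prod_norm_pow_le (μ := μ) (Finset.univ : Finset (Fin 3))
      (f := fun i x => f (x, ![a, b, c] i) ^ 3) (p := fun _ => 1 / 3)
      (by intro i _; fun_prop) (by simp) (by intro i _; norm_num)
    have e : ∀ z : ℝ≥0∞, (z ^ 3) ^ (1 / 3 : ℝ) = z := by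
      intro z
      rw [← ENNReal.rpow_natCast, ← ENNReal.rpow_mul]
      norm_num
    simp only [Fin.prod_univ_three, e] at h
    exact h
  have expand : ∀ F : Y → ℝ≥0∞, Measurable F → (∫⁻ a, F a ∂ν) ^ 3 =
      ∫⁻ a, ∫⁻ b, ∫⁻ c, F a * F b * F c ∂ν ∂ν ∂ν := by
    intro F hF
    have : ∀ a b, ∫⁻ c, F a * F b * F c ∂ν = F a * (F b * ∫⁻ c, F c ∂ν) := by
      intro a b
      rw [lintegral_const_mul _ hF, mul_assoc]
    simp_rw [this]
    have h2 : ∀ a, ∫⁻ b, F a * (F b * ∫⁻ c, F c ∂ν) ∂ν = F a * ((∫⁻ c, F c ∂ν) * ∫⁻ c, F c ∂ν) := by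
      intro a
      rw [lintegral_const_mul _ (by fun_prop), lintegral_mul_const _ hF]
    simp_rw [h2]
    rw [lintegral_mul_const _ hF]
    ring
  rw [expand N hNm]
  calc _ = ∫⁻ x, ∫⁻ a, ∫⁻ b, ∫⁻ c, f (x, a) * f (x, b) * f (x, c) ∂ν ∂ν ∂ν ∂μ := by
        congr 1; ext x
        rw [expand _ (by fun_prop)]
    _ = ∫⁻ a, ∫⁻ x, ∫⁻ b, ∫⁻ c, f (x, a) * f (x, b) * f (x, c) ∂ν ∂ν ∂μ ∂ν := by
        rw [lintegral_lintegral_swap]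
        apply Measurable.aemeasurable
        unfold Function.uncurry
        apply Measurable.lintegral_prod_right' (f := fun q : (X × Y) × Y =>
          ∫⁻ c, f (q.1.1, q.1.2) * f (q.1.1, q.2) * f (q.1.1, c) ∂ν)
        apply Measurable.lintegral_prod_right' (f := fun q : ((X × Y) × Y) × Y =>
          f (q.1.1.1, q.1.1.2) * f (q.1.1.1, q.1.2) * f (q.1.1.1, q.2))
        fun_prop
    _ = ∫⁻ a, ∫⁻ b, ∫⁻ x, ∫⁻ c, f (x, a) * f (x, b) * f (x, c) ∂ν ∂μ ∂ν ∂ν := by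
        congr 1; ext a
        rw [lintegral_lintegral_swap]
        apply Measurable.aemeasurable
        unfold Function.uncurry
        apply Measurable.lintegral_prod_right' (f := fun q : (X × Y) × Y =>
          f (q.1.1, a) * f (q.1.1, q.1.2) * f (q.1.1, q.2))
        fun_prop
    _ = ∫⁻ a, ∫⁻ b, ∫⁻ c, ∫⁻ x, f (x, a) * f (x, b) * f (x, c) ∂μ ∂ν ∂ν ∂ν := by
        congr 1; ext a
        congr 1; ext b
        rw [lintegral_lintegral_swap]
        apply Measurable.aemeasurable
        unfold Function.uncurry
        fun_prop
    _ ≤ _ := by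
        gcongr with a b c
        exact hold a b c

/-- the weight `√(1+a²)` -/
def rr (a : ℝ) : ℝ := √(1 + a ^ 2)

theorem rr_pos (a : ℝ) : 0 < rr a := Real.sqrt_pos.2 (by positivity)
theorem rr_sq (a : ℝ) : rr a ^ 2 = 1 + a ^ 2 := Real.sq_sqrt (by positivity)
@[fun_prop]
theorem rr_meas : Measurable rr := by unfold rr; fun_prop

theorem phi_deriv (a : ℝ) : HasDerivAt (fun a => a / rr a) (1 / rr a ^ 3) a := by
  have hp := rr_pos a
  have h1 : HasDerivAt (fun a : ℝ => 1 + a ^ 2) (2 * a) a := by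
    simpa using ((hasDerivAt_pow 2 a).const_add 1)
  have h2 : HasDerivAt rr (2 * a / (2 * rr a)) a := h1.sqrt (by positivity)
  refine ((hasDerivAt_id' a).div h2 hp.ne').congr_deriv ?_
  have h3 := rr_sq a
  field_simp
  linarith

theorem phi_push (Φ : ℝ → ℝ≥0∞) :
    ∫⁻ a, Φ (a / rr a) * ENNReal.ofReal (1 / rr a ^ 3) ≤ 1 * ∫⁻ y, Φ y := by
  have hinj : Function.Injective (fun a => a / rr a) := by
    apply StrictMono.injective
    apply strictMono_of_deriv_pos
    intro a
    rw [(phi_deriv a).deriv]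
    have := rr_pos a
    positivity
  have h := lintegral_image_eq_lintegral_abs_deriv_mul MeasurableSet.univ
    (fun a _ => (phi_deriv a).hasDerivWithinAt) hinj.injOn Φ
  rw [one_mul]
  refine le_trans (le_of_eq ?_) (setLIntegral_le_lintegral ((fun a => a / rr a) '' univ) Φ)
  rw [h, setLIntegral_univ]
  congr 1; ext a
  have := rr_pos a
  rw [abs_of_pos (by positivity), mul_comm]

theorem low1 (D : ℝ) (hD : 0 < D) :
    ∫⁻ a in Ioo 0 D, ENNReal.ofReal (a ^ (-(1 / 3) : ℝ)) ≤ ENNReal.ofReal (3 / 2 * D ^ (2 / 3 : ℝ) - 0) := by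
  refine aux_ftc isOpen_Ioo (convex_Ioo _ _) (fun a => 3 / 2 * a ^ (2 / 3 : ℝ)) _ ?_ ?_ _ _ ?_
  · intro a ha
    refine ((Real.hasDerivAt_rpow_const (Or.inl ha.1.ne')).const_mul (3 / 2 : ℝ)).congr_deriv ?_
    rw [← mul_assoc]; norm_num
  · intro a ha
    have := ha.1
    positivity
  · intro a ha
    have := ha.1
    refine ⟨by positivity, ?_⟩
    have := Real.rpow_le_rpow ha.1.le ha.2.le (by norm_num : (0 : ℝ) ≤ 2 / 3)
    linarith

theorem low2 (L : ℝ) (hL : 0 < L) :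
    ∫⁻ a in Ioi L, ENNReal.ofReal (a ^ (-(7 / 3) : ℝ)) ≤ ENNReal.ofReal (0 - (-(3 / 4 * L ^ (-(4 / 3) : ℝ)))) := by
  refine aux_ftc isOpen_Ioi (convex_Ioi _) (fun a => -(3 / 4 * a ^ (-(4 / 3) : ℝ))) _ ?_ ?_ _ _ ?_
  · intro a ha
    have ha' : 0 < a := hL.trans ha
    refine ((Real.hasDerivAt_rpow_const (Or.inl ha'.ne')).const_mul (3 / 4 : ℝ)).neg.congr_deriv ?_
    rw [← mul_assoc, ← neg_mul]; norm_num
  · intro a ha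
    have ha' : 0 < a := hL.trans ha
    positivity
  · intro a ha
    have ha' : 0 < a := hL.trans ha
    have h1 := Real.rpow_le_rpow_of_nonpos hL (le_of_lt ha) (by norm_num : (-(4 / 3) : ℝ) ≤ 0)
    have h2 : 0 ≤ a ^ (-(4 / 3) : ℝ) := by positivity
    constructor <;> linarith

theorem low_pt (B : ℝ) (hB : 0 < B) (a : ℝ) (ha : 0 < a) (hw : a ^ (1 / 3 : ℝ) / rr a < B) :
    ENNReal.ofReal (1 / rr a ^ 3) / ENNReal.ofReal (a ^ (1 / 3 : ℝ) / rr a) ≤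
     (Ioo 0 ((2 * B) ^ (3 : ℝ))).indicator (fun a => ENNReal.ofReal (a ^ (-(1 / 3) : ℝ))) a +
     (Ioi ((2 * B) ^ (-(3 / 2) : ℝ))).indicator (fun a => ENNReal.ofReal (a ^ (-(7 / 3) : ℝ))) a := by
  have hr := rr_pos a
  have hr2 := rr_sq a
  have hc : 0 < a ^ (1 / 3 : ℝ) := by positivity
  rw [← ENNReal.ofReal_div_of_pos (by positivity)]
  rw [div_lt_iff₀ hr] at hw
  have hk : 1 / rr a ^ 3 / (a ^ (1 / 3 : ℝ) / rr a) = a ^ (-(1 / 3) : ℝ) * (1 / rr a ^ 2) := by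
    rw [Real.rpow_neg ha.le]
    field_simp
  rw [hk]
  rcases le_or_gt a 1 with h1 | h1
  · have hr3 : rr a ≤ 2 := by nlinarith
    have h3 : a < (2 * B) ^ (3 : ℝ) := by
      have h4 : a ^ (1 / 3 : ℝ) < 2 * B := by nlinarith
      have := Real.rpow_lt_rpow hc.le h4 (by norm_num : (0 : ℝ) < 3)
      rwa [← Real.rpow_mul ha.le, show (1 / 3 : ℝ) * 3 = 1 by norm_num, Real.rpow_one] at this
    rw [indicator_of_mem (show a ∈ Ioo 0 ((2 * B) ^ (3 : ℝ)) from ⟨ha, h3⟩)]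
    refine le_trans ?_ le_self_add
    apply ENNReal.ofReal_le_ofReal
    refine mul_le_of_le_one_right (by positivity) ?_
    rw [div_le_one (by positivity), hr2]
    nlinarith
  · have hr3 : rr a ≤ 2 * a := by nlinarith
    have h3 : (2 * B) ^ (-(3 / 2) : ℝ) < a := by
      have h4 : a ^ (1 / 3 : ℝ) < 2 * B * a := by nlinarith
      have h5 : a ^ (-(2 / 3) : ℝ) < 2 * B := by
        have : a ^ (-(2 / 3) : ℝ) = a ^ (1 / 3 : ℝ) / a := by
          rw [← Real.rpow_sub_one ha.ne']; norm_num
        rw [this, div_lt_iff₀ ha]; exact h4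
      have := Real.rpow_lt_rpow_of_neg (by positivity) h5 (by norm_num : (-(3 / 2) : ℝ) < 0)
      rwa [← Real.rpow_mul ha.le, show (-(2 / 3) : ℝ) * (-(3 / 2)) = 1 by norm_num, Real.rpow_one] at this
    rw [indicator_of_mem (show a ∈ Ioi ((2 * B) ^ (-(3 / 2) : ℝ)) from h3)]
    refine le_trans ?_ le_add_self
    apply ENNReal.ofReal_le_ofReal
    have : a ^ (-(7 / 3) : ℝ) = a ^ (-(1 / 3) : ℝ) * (1 / a ^ 2) := by
      have e : (-(7 / 3) : ℝ) = -(1 / 3) - (2 : ℕ) := by norm_num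
      rw [e, Real.rpow_sub_natCast ha.ne']; ring
    rw [this]
    gcongr
    nlinarith

theorem aux_low (B : ℝ) (hB : 0 < B) :
    ∫⁻ a in {a : ℝ | |a| ^ (1 / 3 : ℝ) / rr a < B},
      ENNReal.ofReal (1 / rr a ^ 3) / ENNReal.ofReal (|a| ^ (1 / 3 : ℝ) / rr a)
      ≤ ENNReal.ofReal (18 * B ^ 2) := by
  set ψ : ℝ → ℝ≥0∞ := fun a =>
     (Ioo 0 ((2 * B) ^ (3 : ℝ))).indicator (fun a => ENNReal.ofReal (a ^ (-(1 / 3) : ℝ))) a +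
     (Ioi ((2 * B) ^ (-(3 / 2) : ℝ))).indicator (fun a => ENNReal.ofReal (a ^ (-(7 / 3) : ℝ))) a with hψ
  have hm1 : Measurable ((Ioo 0 ((2 * B) ^ (3 : ℝ))).indicator (fun a : ℝ => ENNReal.ofReal (a ^ (-(1 / 3) : ℝ)))) :=
    Measurable.indicator (by fun_prop) measurableSet_Ioo
  have hm2 : Measurable ((Ioi ((2 * B) ^ (-(3 / 2) : ℝ))).indicator (fun a : ℝ => ENNReal.ofReal (a ^ (-(7 / 3) : ℝ)))) :=
    Measurable.indicator (by fun_prop) measurableSet_Ioi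
  have hψm : Measurable ψ := hm1.add hm2
  have hψi : ∫⁻ a, ψ a ≤ ENNReal.ofReal (9 * B ^ 2) := by
    rw [hψ, lintegral_add_left hm1, lintegral_indicator measurableSet_Ioo,
      lintegral_indicator measurableSet_Ioi]
    refine (add_le_add (low1 _ (by positivity)) (low2 _ (by positivity))).trans ?_
    have hBB : 0 ≤ 2 * B := by positivity
    rw [← Real.rpow_mul hBB, ← Real.rpow_mul hBB]
    have e1 : (3 : ℝ) * (2 / 3) = (2 : ℕ) := by norm_num
    have e2 : (-(3 / 2) : ℝ) * (-(4 / 3)) = (2 : ℕ) := by norm_num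
    rw [e1, e2, Real.rpow_natCast, ← ENNReal.ofReal_add (by simp; positivity) (by simp; positivity)]
    apply ENNReal.ofReal_le_ofReal
    nlinarith
  have hms : MeasurableSet {a : ℝ | |a| ^ (1 / 3 : ℝ) / rr a < B} :=
    measurableSet_lt (by fun_prop) (by fun_prop)
  calc _ ≤ ∫⁻ a in {a : ℝ | |a| ^ (1 / 3 : ℝ) / rr a < B}, (ψ a + ψ (-a)) := by
        apply lintegral_mono_ae
        rw [ae_restrict_iff' hms]
        have hne : ∀ᵐ a : ℝ, a ≠ 0 := by rw [ae_iff]; simp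
        filter_upwards [hne] with a ha hw
        rcases lt_or_gt_of_ne ha with h | h
        · refine le_trans ?_ le_add_self
          have e : rr a = rr (-a) := by simp [rr]
          have hw' : |a| ^ (1 / 3 : ℝ) / rr a < B := hw
          rw [abs_of_neg h, e] at hw' ⊢
          exact low_pt B hB (-a) (by linarith) hw'
        · refine le_trans ?_ le_self_add
          have hw' : |a| ^ (1 / 3 : ℝ) / rr a < B := hw
          rw [abs_of_pos h] at hw' ⊢
          exact low_pt B hB a h hw'
    _ ≤ ∫⁻ a, (ψ a + ψ (-a)) := setLIntegral_le_lintegral _ _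
    _ = (∫⁻ a, ψ a) + ∫⁻ a, ψ a := by
        rw [lintegral_add_left hψm, lintegral_neg_eq_self]
    _ ≤ ENNReal.ofReal (9 * B ^ 2) + ENNReal.ofReal (9 * B ^ 2) := add_le_add hψi hψi
    _ = _ := by
        rw [← ENNReal.ofReal_add (by positivity) (by positivity)]
        congr 1; ring

theorem aux_A1 (m : ℝ → ℂ) (hmm : Measurable m) (hm : Integrable m) :
    ∫⁻ t : ℝ, ‖∫ a, exp (I * ((t * (a / rr a) : ℝ) : ℂ)) * m a‖ₑ ^ 3
      ≤ ENNReal.ofReal (48 * Real.pi * √18) *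
        (∫⁻ a, ‖m a‖ₑ ^ 2 * ENNReal.ofReal (|a| ^ (1 / 3 : ℝ) * rr a ^ 2)) ^ (3 / 2 : ℝ) := by
  have h := aux_A volume (fun a => a / rr a) (by fun_prop) m hm
    (fun a => ENNReal.ofReal (1 / rr a ^ 3)) (fun a => ‖m a‖ₑ ^ 2 * ENNReal.ofReal (rr a ^ 3))
    (by fun_prop) (by fun_prop) 1 one_ne_zero (fun Φ _ => phi_push Φ) ?_
    (fun a => |a| ^ (1 / 3 : ℝ) / rr a) (by fun_prop) ?_ 18 (by norm_num) aux_low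
  · rw [mul_one] at h
    refine h.trans (le_of_eq ?_)
    congr 3; ext a
    have := rr_pos a
    rw [mul_assoc, ← ENNReal.ofReal_mul (by positivity)]
    congr 2
    field_simp
  · intro a
    have := rr_pos a
    rw [mul_assoc, ← ENNReal.ofReal_mul (by positivity), mul_one_div_cancel (by positivity)]
    simp
  · have hne : ∀ᵐ a : ℝ, a ≠ 0 := by rw [ae_iff]; simp
    filter_upwards [hne] with a ha
    have := rr_pos a
    positivity

end OneDim

section Chain
open Set

theorem cov_lint (f : EuclideanSpace ℝ (Fin 3) → ℝ≥0∞) (hf : Measurable f) :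
    ∫⁻ v, f v = ∫⁻ ξ : ℝ × ℝ, ∫⁻ a : ℝ, ENNReal.ofReal (nr ξ) * f (vec (ξ, a * nr ξ)) := by
  rw [vec_lint f hf]
  apply lintegral_congr_ae
  have hne : ∀ᵐ ξ : ℝ × ℝ, ξ ≠ 0 := by rw [ae_iff]; simp
  filter_upwards [hne] with ξ hξ
  have hn := nr_pos hξ
  have h1' : Measurable fun a : ℝ => f (vec (ξ, a * nr ξ)) := hf.comp (vec_meas.comp (by fun_prop))
  rw [lintegral_const_mul _ h1']
  have h := lint_scale (fun s => f (vec (ξ, s))) (nr ξ) hn.ne'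
  simp_rw [mul_comm _ (nr ξ)]
  rw [h, ← mul_assoc, ← ENNReal.ofReal_mul hn.le, abs_of_pos (by positivity), mul_inv_cancel₀ hn.ne']
  simp

theorem norm_vec (ξ : ℝ × ℝ) (a : ℝ) : ‖vec (ξ, a * nr ξ)‖ = nr ξ * rr a := by
  have h1 := nr_nonneg ξ
  have h2 := rr_pos a
  have h3 : ‖vec (ξ, a * nr ξ)‖ ^ 2 = (nr ξ * rr a) ^ 2 := by
    rw [EuclideanSpace.norm_sq_eq, Fin.sum_univ_three, mul_pow, rr_sq, nr_sq]
    simp [vec, mul_pow, nr_sq]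
    ring
  exact (sq_eq_sq₀ (norm_nonneg _) (by positivity)).1 h3

theorem pRot_vec (ξ : ℝ × ℝ) (hξ : ξ ≠ 0) (a : ℝ) : pRot (vec (ξ, a * nr ξ)) = a / rr a := by
  have h1 := nr_pos hξ
  have h2 := rr_pos a
  rw [pRot, norm_vec]
  simp only [vec]
  simp
  field_simp

/-- the slice function -/
def sl (G : EuclideanSpace ℝ (Fin 3) → ℂ) (a : ℝ) (ξ : ℝ × ℝ) : ℂ :=
  G (vec (ξ, a * nr ξ)) * ((nr ξ : ℝ) : ℂ)

theorem sl_meas (G : EuclideanSpace ℝ (Fin 3) → ℂ) (hG : Measurable G) :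
    Measurable (fun q : (ℝ × ℝ) × ℝ => sl G q.2 q.1) := by
  unfold sl
  exact (hG.comp (vec_meas.comp (by fun_prop))).mul (by fun_prop)

theorem sl_enorm (G : EuclideanSpace ℝ (Fin 3) → ℂ) (a : ℝ) (ξ : ℝ × ℝ) :
    ‖sl G a ξ‖ₑ = ENNReal.ofReal (nr ξ) * ‖G (vec (ξ, a * nr ξ))‖ₑ := by
  rw [sl, enorm_mul, mul_comm, ← ofReal_norm (((nr ξ : ℝ) : ℂ)), Complex.norm_real, Real.norm_of_nonneg (nr_nonneg ξ)]

theorem sl_int (G : EuclideanSpace ℝ (Fin 3) → ℂ) (hG : Measurable G) (hi : Integrable G) :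
    Integrable (fun q : (ℝ × ℝ) × ℝ => sl G q.2 q.1) := by
  refine ⟨(sl_meas G hG).aestronglyMeasurable, ?_⟩
  rw [hasFiniteIntegral_iff_enorm]
  have h1 : ∫⁻ q : (ℝ × ℝ) × ℝ, ‖sl G q.2 q.1‖ₑ = ∫⁻ v, ‖G v‖ₑ := by
    rw [cov_lint _ (by fun_prop)]
    refine (lintegral_prod _ (sl_meas G hG).enorm.aemeasurable).trans ?_
    simp_rw [sl_enorm]
  rw [h1]
  exact hi.2

/-- the slice wave -/
def HH (G : EuclideanSpace ℝ (Fin 3) → ℂ) (x : EuclideanSpace ℝ (Fin 3)) (a : ℝ) : ℂ :=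
  ∫ ξ : ℝ × ℝ, exp (I * ((⟪x, vec (ξ, a * nr ξ)⟫ : ℝ) : ℂ)) * sl G a ξ

theorem ph_meas : Measurable (fun q : (EuclideanSpace ℝ (Fin 3) × ℝ) × (ℝ × ℝ) =>
    exp (I * ((⟪q.1.1, vec (q.2, q.1.2 * nr q.2)⟫ : ℝ) : ℂ))) := by
  have : Measurable fun q : (EuclideanSpace ℝ (Fin 3) × ℝ) × (ℝ × ℝ) => vec (q.2, q.1.2 * nr q.2) :=
    vec_meas.comp (by fun_prop)
  have h2 : Measurable fun q : (EuclideanSpace ℝ (Fin 3) × ℝ) × (ℝ × ℝ) =>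
    (⟪q.1.1, vec (q.2, q.1.2 * nr q.2)⟫ : ℝ) := Measurable.inner (by fun_prop) this
  fun_prop

theorem HH_meas (G : EuclideanSpace ℝ (Fin 3) → ℂ) (hG : Measurable G) :
    Measurable (fun q : EuclideanSpace ℝ (Fin 3) × ℝ => HH G q.1 q.2) := by
  unfold HH
  apply StronglyMeasurable.measurable
  apply StronglyMeasurable.integral_prod_right' (f := fun q : (EuclideanSpace ℝ (Fin 3) × ℝ) × (ℝ × ℝ) =>
    exp (I * ((⟪q.1.1, vec (q.2, q.1.2 * nr q.2)⟫ : ℝ) : ℂ)) * sl G q.1.2 q.2)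
  apply Measurable.stronglyMeasurable
  exact ph_meas.mul ((sl_meas G hG).comp (by fun_prop : Measurable
    fun q : (EuclideanSpace ℝ (Fin 3) × ℝ) × (ℝ × ℝ) => (q.2, q.1.2)))

theorem HH_meas1 (G : EuclideanSpace ℝ (Fin 3) → ℂ) (hG : Measurable G)
    (x : EuclideanSpace ℝ (Fin 3)) : Measurable (HH G x) :=
  Measurable.comp (g := fun q : EuclideanSpace ℝ (Fin 3) × ℝ => HH G q.1 q.2)
    (f := fun a : ℝ => (x, a)) (HH_meas G hG) (by fun_prop)

theorem HH_meas2 (G : EuclideanSpace ℝ (Fin 3) → ℂ) (hG : Measurable G)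
    (a : ℝ) : Measurable (fun x => HH G x a) :=
  Measurable.comp (g := fun q : EuclideanSpace ℝ (Fin 3) × ℝ => HH G q.1 q.2)
    (f := fun x : EuclideanSpace ℝ (Fin 3) => (x, a)) (HH_meas G hG) (by fun_prop)

theorem sl_meas1 (G : EuclideanSpace ℝ (Fin 3) → ℂ) (hG : Measurable G)
    (a : ℝ) : Measurable (sl G a) :=
  Measurable.comp (g := fun q : (ℝ × ℝ) × ℝ => sl G q.2 q.1)
    (f := fun ξ : ℝ × ℝ => (ξ, a)) (sl_meas G hG) (by fun_prop)

theorem ph_int (G : EuclideanSpace ℝ (Fin 3) → ℂ) (hG : Measurable G) (hi : Integrable G)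
    (x : EuclideanSpace ℝ (Fin 3)) (ψ : ℝ → ℝ) (hψ : Measurable ψ) :
    Integrable (fun q : (ℝ × ℝ) × ℝ =>
      exp (I * ((ψ q.2 : ℝ) : ℂ)) * (exp (I * ((⟪x, vec (q.1, q.2 * nr q.1)⟫ : ℝ) : ℂ)) * sl G q.2 q.1)) := by
  refine (sl_int G hG hi).mono ?_ ?_
  · apply Measurable.aestronglyMeasurable
    have := ph_meas.comp (by fun_prop : Measurable fun q : (ℝ × ℝ) × ℝ => ((x, q.2), q.1))
    exact Measurable.mul (by fun_prop) (this.mul (sl_meas G hG))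
  · refine Filter.Eventually.of_forall fun q => ?_
    rw [aux_norm_exp, aux_norm_exp]

theorem HH_int (G : EuclideanSpace ℝ (Fin 3) → ℂ) (hG : Measurable G) (hi : Integrable G)
    (x : EuclideanSpace ℝ (Fin 3)) : Integrable (HH G x) := by
  have h := (ph_int G hG hi x (fun _ => 0) (by fun_prop)).integral_prod_right
  simp only [Complex.ofReal_zero, mul_zero, Complex.exp_zero, one_mul] at h
  exact h

theorem W_eq (G : EuclideanSpace ℝ (Fin 3) → ℂ) (hG : Measurable G) (hi : Integrable G)
    (x : EuclideanSpace ℝ (Fin 3)) (t : ℝ) :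
    ∫ v, exp (I * ((⟪x, v⟫ + t * pRot v : ℝ) : ℂ)) * G v =
      ∫ a, exp (I * ((t * (a / rr a) : ℝ) : ℂ)) * HH G x a := by
  have hpm : Measurable pRot := by unfold pRot; fun_prop
  set F : EuclideanSpace ℝ (Fin 3) → ℂ := fun v => exp (I * ((⟪x, v⟫ + t * pRot v : ℝ) : ℂ)) * G v with hF
  have hFi : Integrable F := by
    refine hi.mono ?_ (Filter.Eventually.of_forall fun v => (aux_norm_exp _ _).le)
    apply Measurable.aestronglyMeasurable
    fun_prop
  have hFi' : Integrable (fun q => F (vec q)) :=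
    (vec_mp_emb.1.integrable_comp_emb vec_mp_emb.2).2 hFi
  calc _ = ∫ q, F (vec q) := (vec_mp_emb.1.integral_comp vec_mp_emb.2 F).symm
    _ = ∫ ξ : ℝ × ℝ, ∫ s : ℝ, F (vec (ξ, s)) := integral_prod _ hFi'
    _ = ∫ ξ : ℝ × ℝ, ∫ a : ℝ, exp (I * ((t * (a / rr a) : ℝ) : ℂ)) *
          (exp (I * ((⟪x, vec (ξ, a * nr ξ)⟫ : ℝ) : ℂ)) * sl G a ξ) := by
        apply integral_congr_ae
        have hne : ∀ᵐ ξ : ℝ × ℝ, ξ ≠ 0 := by rw [ae_iff]; simp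
        filter_upwards [hne] with ξ hξ
        have hn := nr_pos hξ
        have h := Measure.integral_comp_mul_left (fun s => F (vec (ξ, s))) (nr ξ)
        have h2 : ∫ s : ℝ, F (vec (ξ, s)) = ((nr ξ : ℝ) : ℂ) * ∫ s : ℝ, F (vec (ξ, nr ξ * s)) := by
          rw [h, abs_of_pos (by positivity), Complex.real_smul, ← mul_assoc, ← Complex.ofReal_mul,
            mul_inv_cancel₀ hn.ne']
          simp
        rw [h2, ← integral_const_mul]
        congr 1; ext a
        rw [mul_comm (nr ξ) a]
        simp only [hF, sl]
        rw [pRot_vec ξ hξ, Complex.ofReal_add, mul_add, Complex.exp_add]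
        ring
    _ = ∫ a : ℝ, ∫ ξ : ℝ × ℝ, exp (I * ((t * (a / rr a) : ℝ) : ℂ)) *
          (exp (I * ((⟪x, vec (ξ, a * nr ξ)⟫ : ℝ) : ℂ)) * sl G a ξ) :=
        integral_integral_swap (ph_int G hG hi x (fun a => t * (a / rr a)) (by fun_prop))
    _ = _ := by
        congr 1; ext a
        rw [integral_const_mul, HH]

theorem sq_aux {A K X : ℝ≥0∞} (h : A ≤ K * X ^ (3 / 2 : ℝ)) : A ^ 2 ≤ K ^ 2 * X ^ 3 := by
  refine (pow_le_pow_left' h 2).trans (le_of_eq ?_)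
  rw [mul_pow, ← ENNReal.rpow_natCast (X ^ _), ← ENNReal.rpow_mul, ← ENNReal.rpow_natCast X 3]
  congr 2
  norm_num

set_option maxHeartbeats 1000000 in
theorem aux_main (G : EuclideanSpace ℝ (Fin 3) → ℂ) (hG : Measurable G) (hi : Integrable G) :
    ∫⁻ x : EuclideanSpace ℝ (Fin 3), (∫⁻ t : ℝ,
      ‖∫ v, exp (I * ((⟪x, v⟫ + t * pRot v : ℝ) : ℂ)) * G v‖ₑ ^ 3) ^ 2 ≤
      ENNReal.ofReal (48 * Real.pi * √18) ^ 2 * (ENNReal.ofReal ((2 * Real.pi) ^ 5) *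
        (∫⁻ v, ENNReal.ofReal (‖v‖ ^ 2) * ‖G v‖ₑ ^ 2) ^ 3) := by
  have hpi := Real.pi_pos
  have hHm := HH_meas G hG
  have hsm := sl_meas G hG
  set w : ℝ → ℝ≥0∞ := fun a => ENNReal.ofReal (|a| ^ (1 / 3 : ℝ) * rr a ^ 2) with hw
  have hwm : Measurable w := by fun_prop
  set c : ℝ≥0∞ := ENNReal.ofReal ((2 * Real.pi) ^ 5) with hc
  have e13 : ∀ z : ℝ≥0∞, (z ^ 3) ^ (1 / 3 : ℝ) = z := by
    intro z
    rw [← ENNReal.rpow_natCast, ← ENNReal.rpow_mul]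
    norm_num
  calc _ ≤ ∫⁻ x : EuclideanSpace ℝ (Fin 3), ENNReal.ofReal (48 * Real.pi * √18) ^ 2 *
          (∫⁻ a, ‖HH G x a‖ₑ ^ 2 * w a) ^ 3 := by
        apply lintegral_mono; intro x
        simp only
        simp_rw [W_eq G hG hi x]
        have h := aux_A1 (HH G x) (HH_meas1 G hG x) (HH_int G hG hi x)
        exact sq_aux h
    _ = ENNReal.ofReal (48 * Real.pi * √18) ^ 2 * ∫⁻ x : EuclideanSpace ℝ (Fin 3),
          (∫⁻ a, ‖HH G x a‖ₑ ^ 2 * w a) ^ 3 := by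
        rw [lintegral_const_mul]
        apply Measurable.pow_const
        exact Measurable.lintegral_prod_right' (f := fun q : EuclideanSpace ℝ (Fin 3) × ℝ =>
          ‖HH G q.1 q.2‖ₑ ^ 2 * w q.2) (by fun_prop)
    _ ≤ _ := by
        gcongr
        refine (aux_mink volume volume (fun q : EuclideanSpace ℝ (Fin 3) × ℝ =>
          ‖HH G q.1 q.2‖ₑ ^ 2 * w q.2) (by fun_prop)).trans ?_
        have step : ∫⁻ a : ℝ, (∫⁻ x : EuclideanSpace ℝ (Fin 3), (‖HH G x a‖ₑ ^ 2 * w a) ^ 3) ^ (1 / 3 : ℝ)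
            ≤ c ^ (1 / 3 : ℝ) * ∫⁻ v, ENNReal.ofReal (‖v‖ ^ 2) * ‖G v‖ₑ ^ 2 := by
          calc _ ≤ ∫⁻ a : ℝ, c ^ (1 / 3 : ℝ) * ∫⁻ ξ : ℝ × ℝ, ENNReal.ofReal (nr ξ) *
                  (ENNReal.ofReal (‖vec (ξ, a * nr ξ)‖ ^ 2) * ‖G (vec (ξ, a * nr ξ))‖ₑ ^ 2) := by
                apply lintegral_mono_ae
                have hne : ∀ᵐ a : ℝ, a ≠ 0 := by rw [ae_iff]; simp
                filter_upwards [hne, (sl_int G hG hi).prod_left_ae] with a ha hai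
                have hsa : Measurable (sl G a) := sl_meas1 G hG a
                have hB := aux_B a ha (sl G a) hsa hai (by simp [sl, nr_zero])
                have e1 : ∫⁻ x : EuclideanSpace ℝ (Fin 3), (‖HH G x a‖ₑ ^ 2 * w a) ^ 3 =
                    (∫⁻ x : EuclideanSpace ℝ (Fin 3), ‖HH G x a‖ₑ ^ 6) * w a ^ 3 := by
                  rw [← lintegral_mul_const _
                    ((HH_meas2 G hG a).enorm.pow_const 6)]
                  congr 1; ext x
                  ring
                rw [e1]
                have e2 : (∫⁻ x : EuclideanSpace ℝ (Fin 3), ‖HH G x a‖ₑ ^ 6) * w a ^ 3 ≤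
                    (ENNReal.ofReal ((2 * Real.pi) ^ 5 * |a⁻¹|) *
                      (∫⁻ ξ, ‖sl G a ξ‖ₑ ^ 2 * ENNReal.ofReal (nr ξ)) ^ 3) * w a ^ 3 := by
                  gcongr
                  exact hB
                refine (ENNReal.rpow_le_rpow e2 (by norm_num)).trans (le_of_eq ?_)
                have e3 : ENNReal.ofReal ((2 * Real.pi) ^ 5 * |a⁻¹|) *
                      (∫⁻ ξ, ‖sl G a ξ‖ₑ ^ 2 * ENNReal.ofReal (nr ξ)) ^ 3 * w a ^ 3 =
                      c * (ENNReal.ofReal (rr a ^ 2) * ∫⁻ ξ, ‖sl G a ξ‖ₑ ^ 2 * ENNReal.ofReal (nr ξ)) ^ 3 := by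
                  have e4 : ENNReal.ofReal |a⁻¹| * w a ^ 3 = ENNReal.ofReal (rr a ^ 2) ^ 3 := by
                    have hr := rr_pos a
                    have ha' : 0 < |a| := abs_pos.2 ha
                    rw [hw]
                    simp only
                    rw [← ENNReal.ofReal_pow (by positivity), ← ENNReal.ofReal_pow (by positivity),
                      ← ENNReal.ofReal_mul (by positivity)]
                    congr 1
                    rw [mul_pow, ← Real.rpow_mul_natCast ha'.le, abs_inv]
                    norm_num
                    field_simp
                  rw [ENNReal.ofReal_mul (by positivity), mul_pow (ENNReal.ofReal (rr a ^ 2)), ← e4]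
                  ring
                rw [e3, ENNReal.mul_rpow_of_nonneg _ _ (by norm_num), e13]
                congr 1
                rw [← lintegral_const_mul _ (by fun_prop)]
                congr 1; ext ξ
                rw [sl_enorm, norm_vec, mul_pow, mul_pow, ENNReal.ofReal_mul (by positivity),
                  ENNReal.ofReal_pow (nr_nonneg ξ)]
                ring
            _ = _ := by
                have hM : Measurable (fun q : (ℝ × ℝ) × ℝ => ENNReal.ofReal (nr q.1) *
                  (ENNReal.ofReal (‖vec (q.1, q.2 * nr q.1)‖ ^ 2) * ‖G (vec (q.1, q.2 * nr q.1))‖ₑ ^ 2)) := by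
                  have hv : Measurable fun q : (ℝ × ℝ) × ℝ => vec (q.1, q.2 * nr q.1) :=
                    vec_meas.comp (by fun_prop)
                  fun_prop
                rw [lintegral_const_mul, cov_lint _ (by fun_prop), lintegral_lintegral_swap]
                · exact (hM.comp measurable_swap).aemeasurable
                · exact hM.lintegral_prod_left'
        refine (pow_le_pow_left' step 3).trans (le_of_eq ?_)
        rw [mul_pow, ← ENNReal.rpow_natCast (c ^ _), ← ENNReal.rpow_mul]
        norm_num

end Chain

section Final
open scoped FourierTransform SchwartzMap

theorem fourierTf_eq (g : SchwartzMap (EuclideanSpace ℝ (Fin 3)) ℂ) (ξ : EuclideanSpace ℝ (Fin 3)) :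
    fourierTf (fun y => g y) ξ = (𝓕 g : SchwartzMap (EuclideanSpace ℝ (Fin 3)) ℂ) ((2 * Real.pi)⁻¹ • ξ) := by
  have hpi := Real.pi_pos
  rw [SchwartzMap.fourier_coe, Real.fourier_eq', fourierTf]
  congr 1; ext v
  rw [smul_eq_mul, inner_smul_right]
  congr 2
  have : -2 * Real.pi * ((2 * Real.pi)⁻¹ * (⟪v, ξ⟫ : ℝ)) = -(⟪v, ξ⟫ : ℝ) := by
    field_simp
  rw [this]
  push_cast
  ring

theorem fourierTf_meas (g : SchwartzMap (EuclideanSpace ℝ (Fin 3)) ℂ) :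
    Measurable (fourierTf (fun y => g y)) := by
  have : fourierTf (fun y => g y) = fun ξ => (𝓕 g : SchwartzMap (EuclideanSpace ℝ (Fin 3)) ℂ)
    ((2 * Real.pi)⁻¹ • ξ) := funext (fourierTf_eq g)
  rw [this]
  apply Continuous.measurable
  exact (𝓕 g : SchwartzMap (EuclideanSpace ℝ (Fin 3)) ℂ).continuous.comp (by fun_prop)

theorem fourierTf_int (g : SchwartzMap (EuclideanSpace ℝ (Fin 3)) ℂ) :
    Integrable (fourierTf (fun y => g y)) := by
  have : fourierTf (fun y => g y) = fun ξ => (𝓕 g : SchwartzMap (EuclideanSpace ℝ (Fin 3)) ℂ)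
    ((2 * Real.pi)⁻¹ • ξ) := funext (fourierTf_eq g)
  rw [this]
  have hpi := Real.pi_pos
  exact (𝓕 g : SchwartzMap (EuclideanSpace ℝ (Fin 3)) ℂ).integrable.comp_smul (by positivity)

theorem fourierTf_int2 (g : SchwartzMap (EuclideanSpace ℝ (Fin 3)) ℂ) :
    Integrable (fun ξ => ‖ξ‖ ^ 2 * ‖fourierTf (fun y => g y) ξ‖ ^ 2) := by
  have hpi := Real.pi_pos
  set k : SchwartzMap (EuclideanSpace ℝ (Fin 3)) ℂ := 𝓕 g with hk
  obtain ⟨C, hC⟩ := k.decay 0 0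
  have hC' : ∀ x, ‖k x‖ ≤ C := by
    intro x; simpa using hC.2 x
  have h1 : Integrable (fun ξ => ‖ξ‖ ^ 2 * ‖k ξ‖ ^ 2) := by
    refine ((k.integrable_pow_mul volume 2).const_mul C).mono ?_ ?_
    · apply Continuous.aestronglyMeasurable
      have := k.continuous
      fun_prop
    · refine Filter.Eventually.of_forall fun ξ => ?_
      have hC0 : 0 ≤ C := hC.1.le
      rw [Real.norm_of_nonneg (by positivity), Real.norm_of_nonneg (by positivity)]
      have := hC' ξ
      calc _ = ‖k ξ‖ * (‖ξ‖ ^ 2 * ‖k ξ‖) := by ring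
        _ ≤ _ := by gcongr
  have h2 := (h1.comp_smul (R := (2 * Real.pi)⁻¹) (by positivity)).const_mul ((2 * Real.pi) ^ 2)
  refine h2.congr (Filter.Eventually.of_forall fun ξ => ?_)
  simp only
  rw [fourierTf_eq, norm_smul, Real.norm_of_nonneg (by positivity), ← hk]
  field_simp

theorem final_alg (K P ε J : ℝ) (hK : 0 < K) (hP : 0 < P) (hε : 0 < ε) (hJ : 0 ≤ J) :
    (ε ^ 2 * (K ^ 2 * (P * J ^ 3))) ^ (1 / 6 : ℝ) =
      (K ^ 2 * P) ^ (1 / 6 : ℝ) * ε ^ (1 / 3 : ℝ) * J ^ (1 / 2 : ℝ) := by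
  have e : ε ^ 2 * (K ^ 2 * (P * J ^ 3)) = (K ^ 2 * P) * ε ^ 2 * J ^ 3 := by ring
  rw [e, Real.mul_rpow (by positivity) (by positivity), Real.mul_rpow (by positivity) (by positivity),
    ← Real.rpow_natCast_mul hε.le, ← Real.rpow_natCast_mul hJ]
  norm_num

end Final

theorem strichartz_rotating_euler_reversed :
    ∃ C : ℝ, 0 < C ∧ ∀ ε : ℝ, 0 < ε → ∀ sgn : ℝ, (sgn = 1 ∨ sgn = -1) →
      ∀ g : SchwartzMap (EuclideanSpace ℝ (Fin 3)) ℂ,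
        (∫⁻ x : EuclideanSpace ℝ (Fin 3),
            (∫⁻ t : ℝ,
              (‖(∫ ξ : EuclideanSpace ℝ (Fin 3),
                  Complex.exp (Complex.I *
                    Complex.ofReal (⟪x, ξ⟫ + sgn * (t / ε) * pRot ξ)) *
                    fourierTf (fun y => g y) ξ)‖₊ : ℝ≥0∞) ^ 3) ^ 2) ^ (1 / 6 : ℝ)
          ≤ ENNReal.ofReal (C * ε ^ (1 / 3 : ℝ) * sobolevNorm 1 (fun y => g y)) := by
  have hpi := Real.pi_pos
  set K : ℝ := 48 * Real.pi * √18 with hK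
  set P : ℝ := (2 * Real.pi) ^ 5 with hP
  have hKpos : 0 < K := by positivity
  have hPpos : 0 < P := by positivity
  refine ⟨(K ^ 2 * P) ^ (1 / 6 : ℝ), by positivity, ?_⟩
  intro ε hε sgn hsgn g
  set G := fourierTf (fun y => g y) with hG
  set J : ℝ := ∫ ξ, ‖ξ‖ ^ 2 * ‖G ξ‖ ^ 2 with hJ
  have hJ0 : 0 ≤ J := integral_nonneg fun ξ => by positivity
  have hsob : sobolevNorm 1 (fun y => g y) = J ^ (1 / 2 : ℝ) := by
    rw [sobolevNorm, hJ]
    congr 2; ext ξ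
    rw [← Real.rpow_natCast ‖ξ‖ 2, hG]
    norm_num
  have hJl : ∫⁻ v, ENNReal.ofReal (‖v‖ ^ 2) * ‖G v‖ₑ ^ 2 = ENNReal.ofReal J := by
    rw [hJ, ofReal_integral_eq_lintegral_ofReal (fourierTf_int2 g)
      (Filter.Eventually.of_forall fun ξ => by positivity)]
    congr 1; ext v
    rw [ENNReal.ofReal_mul (by positivity), ENNReal.ofReal_pow (norm_nonneg (G v)), ofReal_norm]
  have main := aux_main G (fourierTf_meas g) (fourierTf_int g)
  rw [hJl] at main
  have hb : sgn / ε ≠ 0 := by rcases hsgn with h | h <;> simp [h, hε.ne']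
  have hbi : |(sgn / ε)⁻¹| = ε := by
    rcases hsgn with h | h <;> simp [h, abs_of_pos hε, div_neg]
  have hX : (∫⁻ x : EuclideanSpace ℝ (Fin 3),
            (∫⁻ t : ℝ,
              (‖(∫ ξ : EuclideanSpace ℝ (Fin 3),
                  Complex.exp (Complex.I *
                    Complex.ofReal (⟪x, ξ⟫ + sgn * (t / ε) * pRot ξ)) *
                    G ξ)‖₊ : ℝ≥0∞) ^ 3) ^ 2) =
      ENNReal.ofReal ε ^ 2 * ∫⁻ x : EuclideanSpace ℝ (Fin 3), (∫⁻ t : ℝ,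
      ‖∫ v, exp (I * ((⟪x, v⟫ + t * pRot v : ℝ) : ℂ)) * G v‖ₑ ^ 3) ^ 2 := by
    rw [← lintegral_const_mul' _ _ (by simp)]
    congr 1; ext x
    rw [← mul_pow]
    congr 1
    have h := lint_scale (fun t => ‖∫ v, exp (I * ((⟪x, v⟫ + t * pRot v : ℝ) : ℂ)) * G v‖ₑ ^ 3) (sgn / ε) hb
    rw [hbi] at h
    rw [← h]
    congr 1; ext t
    have e : sgn * (t / ε) = sgn / ε * t := by ring
    rw [e, enorm_eq_nnnorm]
  rw [hX, hsob, ← final_alg K P ε J hKpos hPpos hε hJ0,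
    ← ENNReal.ofReal_rpow_of_nonneg (by positivity) (by norm_num)]
  apply ENNReal.rpow_le_rpow _ (by norm_num)
  rw [ENNReal.ofReal_mul (by positivity), ENNReal.ofReal_mul (by positivity),
    ENNReal.ofReal_mul (by positivity), ENNReal.ofReal_pow hε.le, ENNReal.ofReal_pow hKpos.le,
    ENNReal.ofReal_pow hJ0]
  gcongr

end
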